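/- arXiv:1104.0870 — 2 statements merged into one kernel-verified Lean document; each statement's English description precedes it below -/
import Mathlib

section
/- Suppose N = d(n−d) is even. Then the number of rotationally-invariant standard Young tableaux of rectangular shape Rect = (n−d)^d equals the number of standard 2-ribbon (domino) tableaux of shape Rect. -/
open Polynomial

noncomputable section

/-! ### The Grassmannian `X = Gr(d, ℂ_{n-1}[z])` and the Wronski map -/

/-- The Wronskian determinant of a `d`-tuple of polynomials. -/
def wronskDet (d : ℕ) (f : Fin d → Polynomial ℂ) : Polynomial ℂ :=
  Matrix.det (Matrix.of fun i j : Fin d =>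
    (fun p : Polynomial ℂ => Polynomial.derivative p)^[(j : ℕ)] (f i))

/-- `x` is a point of the Grassmannian `Gr(d, ℂ_{n-1}[z])`. -/
def IsGrPoint (n d : ℕ) (x : Submodule ℂ (Polynomial ℂ)) : Prop :=
  x ≤ Polynomial.degreeLT ℂ n ∧ Module.finrank ℂ x = d

/-- `x` lies in the fibre of the Wronski map over `h` (an element of the
projective space `ℙ(ℂ_N[z])`, i.e. the Wronskian of a basis of `x` is a nonzero
scalar multiple of `h`). -/
def InFibre (d : ℕ) (x : Submodule ℂ (Polynomial ℂ)) (h : Polynomial ℂ) : Prop :=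
  ∃ (f : Fin d → Polynomial ℂ) (c : ℂ), c ≠ 0 ∧ LinearIndependent ℂ f ∧
    Submodule.span ℂ (Set.range f) = x ∧ wronskDet d f = c • h

/-- The linear substitution `f(z) ↦ f(c·z)` on polynomials. -/
def rotMap (c : ℂ) : Polynomial ℂ →ₗ[ℂ] Polynomial ℂ :=
  (Polynomial.aeval (Polynomial.C c * Polynomial.X) :
    Polynomial ℂ →ₐ[ℂ] Polynomial ℂ).toLinearMap

/-- `x` is fixed by the cyclic group `C_r ⊂ PGL₂(ℂ)` of classes of
`diag(e^{πij/r}, e^{-πij/r})`, `j = 0, …, r-1`; the induced (projective) action on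
`Gr(d, ℂ_{n-1}[z])` is via the substitutions `z ↦ e^{-2πij/r} z`. -/
def CrFixed (r : ℕ) (x : Submodule ℂ (Polynomial ℂ)) : Prop :=
  ∀ j : Fin r,
    Submodule.map
      (rotMap (Complex.exp (-(2 * (Real.pi : ℂ) * Complex.I * ((j : ℕ) : ℂ)) / (r : ℂ)))) x = x

/-- The linear map `f(z) ↦ z^{n-1} f(1/z)` on `ℂ_{n-1}[z]`,
realizing the reflection `(0 1; 1 0) ∈ PGL₂(ℂ)`. -/
def reflectMap (n : ℕ) : Polynomial ℂ →ₗ[ℂ] Polynomial ℂ :=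
  ∑ k ∈ Finset.range n,
    (Polynomial.lcoeff ℂ k).smulRight ((Polynomial.X : Polynomial ℂ) ^ (n - 1 - k))

/-- `x` is fixed by the dihedral group `D_r ⊂ PGL₂(ℂ)` generated by `C_r` and the
reflection `z ↦ 1/z`. -/
def DrFixed (n r : ℕ) (x : Submodule ℂ (Polynomial ℂ)) : Prop :=
  CrFixed r x ∧ Submodule.map (reflectMap n) x = x

/-! ### Partitions, Richardson varieties, compatibility -/

/-- A partition with at most `d` parts, each of size at most `w`
(recorded as a function `ℕ → ℕ` vanishing from index `d` on; part `i` (0-based)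
is the `(i+1)`-st part). -/
structure PartitionIn (d w : ℕ) where
  part : ℕ → ℕ
  antitone : ∀ ⦃i j : ℕ⦄, i ≤ j → part j ≤ part i
  le_w : ∀ i, part i ≤ w
  eq_zero : ∀ i, d ≤ i → part i = 0

/-- The size `|λ|` of a partition. -/
def PartitionIn.size {d w : ℕ} (lam : PartitionIn d w) : ℕ :=
  ∑ i ∈ Finset.range d, lam.part i

/-- Containment `μ ⊆ λ` of partitions. -/
def SubPartition {d w : ℕ} (mu lam : PartitionIn d w) : Prop :=
  ∀ i, mu.part i ≤ lam.part i

/-- The full rectangular partition `(w)^d`. -/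
def rectPart (d w : ℕ) : PartitionIn d w :=
  { part := fun i => if i < d then w else 0
    antitone := by
      intro i j hij
      by_cases hj : j < d
      · have hi : i < d := lt_of_le_of_lt hij hj
        simp [hi, hj]
      · simp [hj]
    le_w := by intro i; by_cases hi : i < d <;> simp [hi]
    eq_zero := by intro i hi; simp [Nat.not_lt.mpr hi] }

/-- The empty partition. -/
def zeroPart (d w : ℕ) : PartitionIn d w :=
  { part := fun _ => 0
    antitone := by intro i j _; exact le_rfl
    le_w := fun _ => Nat.zero_le _
    eq_zero := fun _ _ => rfl }

/-- The flag `F_i = z^{n-i} ℂ_{i-1}[z]` inside `ℂ_{n-1}[z]`. -/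
def Fflag (n i : ℕ) : Submodule ℂ (Polynomial ℂ) :=
  Polynomial.degreeLT ℂ n ⊓
    Submodule.restrictScalars ℂ (Ideal.span {(Polynomial.X : Polynomial ℂ) ^ (n - i)})

/-- The flag `F̃_i = ℂ_{i-1}[z]`. -/
def Ftilde (i : ℕ) : Submodule ℂ (Polynomial ℂ) := Polynomial.degreeLT ℂ i

/-- Membership in the Richardson variety `X_{λ/μ}`. -/
def InRichardson (n d : ℕ) (lam mu : PartitionIn d (n - d))
    (x : Submodule ℂ (Polynomial ℂ)) : Prop :=
  ∀ i : ℕ, i < d →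
    i + 1 ≤ Module.finrank ℂ ↥(x ⊓ Fflag n (n - d - mu.part i + (i + 1))) ∧
    i + 1 ≤ Module.finrank ℂ ↥(x ⊓ Ftilde (lam.part (d - 1 - i) + (i + 1)))

/-- The Richardson variety `X_{λ/μ}` is compatible with the polynomial `h`:
`μ ⊆ λ`, `|λ| = deg h` and `|μ| = mindeg h`. -/
def Compatible (n d : ℕ) (lam mu : PartitionIn d (n - d)) (h : Polynomial ℂ) : Prop :=
  SubPartition mu lam ∧ lam.size = h.natDegree ∧ mu.size = h.rootMultiplicity 0

/-! ### Ribbons and tableaux -/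

/-- Two boxes (row, column) are adjacent. -/
def BoxAdj (p q : ℕ × ℕ) : Prop :=
  (p.1 = q.1 ∧ (p.2 + 1 = q.2 ∨ q.2 + 1 = p.2)) ∨
  (p.2 = q.2 ∧ (p.1 + 1 = q.1 ∨ q.1 + 1 = p.1))

/-- A set of boxes is an `r`-ribbon: it has `r` boxes, is connected,
and contains no 2×2 square. -/
def IsRibbon (r : ℕ) (S : Set (ℕ × ℕ)) : Prop :=
  S.ncard = r ∧
  (∀ p ∈ S, ∀ q ∈ S, Relation.ReflTransGen (fun u v => u ∈ S ∧ v ∈ S ∧ BoxAdj u v) p q) ∧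
  ¬ ∃ i j : ℕ, (i, j) ∈ S ∧ (i + 1, j) ∈ S ∧ (i, j + 1) ∈ S ∧ (i + 1, j + 1) ∈ S

/-- The box `(i,j)` (0-based row and column) lies in the skew diagram `λ/μ`. -/
def InShape {d w : ℕ} (lam mu : PartitionIn d w) (i j : ℕ) : Prop :=
  i < d ∧ mu.part i ≤ j ∧ j < lam.part i

/-- `E` is a standard `r`-ribbon tableau of skew shape `λ/μ` with entries `1, …, ℓ`
(recorded as a function on boxes, normalized to `0` off the shape). -/
def IsSRT {d w : ℕ} (r ℓ : ℕ) (lam mu : PartitionIn d w) (E : ℕ → ℕ → ℕ) : Prop :=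
  (∀ i j, ¬ InShape lam mu i j → E i j = 0) ∧
  (∀ i j, InShape lam mu i j → 1 ≤ E i j ∧ E i j ≤ ℓ) ∧
  (∀ i j j', InShape lam mu i j → InShape lam mu i j' → j ≤ j' → E i j ≤ E i j') ∧
  (∀ i i' j, InShape lam mu i j → InShape lam mu i' j → i ≤ i' → E i j ≤ E i' j) ∧
  (∀ k, 1 ≤ k → k ≤ ℓ → IsRibbon r {p : ℕ × ℕ | InShape lam mu p.1 p.2 ∧ E p.1 p.2 = k})

/-- A tableau (with boxes inside the `d × w` rectangle and largest entry `m`) is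
rotationally invariant: it is fixed by rotating `180°` inside the rectangle and
replacing each entry `k` by `m + 1 - k`. -/
def RotInvariant {d w : ℕ} (m : ℕ) (lam mu : PartitionIn d w) (E : ℕ → ℕ → ℕ) : Prop :=
  ∀ i j, InShape lam mu i j →
    InShape lam mu (d - 1 - i) (w - 1 - j) ∧
    E (d - 1 - i) (w - 1 - j) = m + 1 - E i j

/-- For `ℓ` even: a tableau of shape `λ/μ` with entries `1, …, ℓ-1`, in which the
boxes with entry `k ≠ ℓ/2` form `r`-ribbons and the boxes with entry `ℓ/2`
form a `2r`-ribbon. -/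
def IsHatSRT {d w : ℕ} (r ℓ : ℕ) (lam mu : PartitionIn d w) (E : ℕ → ℕ → ℕ) : Prop :=
  (∀ i j, ¬ InShape lam mu i j → E i j = 0) ∧
  (∀ i j, InShape lam mu i j → 1 ≤ E i j ∧ E i j ≤ ℓ - 1) ∧
  (∀ i j j', InShape lam mu i j → InShape lam mu i j' → j ≤ j' → E i j ≤ E i j') ∧
  (∀ i i' j, InShape lam mu i j → InShape lam mu i' j → i ≤ i' → E i j ≤ E i' j) ∧
  (∀ k, 1 ≤ k → k ≤ ℓ - 1 → k ≠ ℓ / 2 →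
    IsRibbon r {p : ℕ × ℕ | InShape lam mu p.1 p.2 ∧ E p.1 p.2 = k}) ∧
  IsRibbon (2 * r) {p : ℕ × ℕ | InShape lam mu p.1 p.2 ∧ E p.1 p.2 = ℓ / 2}

/-! ### Rectangular standard Young tableaux, promotion and evacuation -/

/-- `E` is a standard Young tableau of rectangular shape `d × w`
(normalized to `0` outside the rectangle). -/
def IsSYT (d w : ℕ) (E : ℕ → ℕ → ℕ) : Prop :=
  (∀ i j, d ≤ i ∨ w ≤ j → E i j = 0) ∧
  (∀ i j, i < d → j < w → 1 ≤ E i j ∧ E i j ≤ d * w) ∧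
  (∀ i j, i < d → j + 1 < w → E i j < E i (j + 1)) ∧
  (∀ i j, i + 1 < d → j < w → E i j < E (i + 1) j) ∧
  (∀ m, 1 ≤ m → m ≤ d * w → ∃ i j, i < d ∧ j < w ∧ E i j = m)

/-- One step of the jeu de taquin slide of the empty box, restricted to the
subtableau of entries `≤ i₀`: the empty box swaps with the smaller of its east
and south neighbours (among entries `≤ i₀`), if any. -/
def slideStep (d w i₀ : ℕ) (E : ℕ → ℕ → ℕ) (p : ℕ × ℕ) : ℕ × ℕ :=
  if (p.1 + 1 < d ∧ E (p.1 + 1) p.2 ≤ i₀) ∧ (p.2 + 1 < w ∧ E p.1 (p.2 + 1) ≤ i₀) then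
    (if E (p.1 + 1) p.2 < E p.1 (p.2 + 1) then (p.1 + 1, p.2) else (p.1, p.2 + 1))
  else if p.1 + 1 < d ∧ E (p.1 + 1) p.2 ≤ i₀ then (p.1 + 1, p.2)
  else if p.2 + 1 < w ∧ E p.1 (p.2 + 1) ≤ i₀ then (p.1, p.2 + 1)
  else p

/-- The path of the empty box in the jeu de taquin slide, starting in the
northwest corner. -/
def slidePath (d w i₀ : ℕ) (E : ℕ → ℕ → ℕ) : ℕ → ℕ × ℕ
  | 0 => (0, 0)
  | k + 1 => slideStep d w i₀ E (slidePath d w i₀ E k)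

/-- Promotion restricted to the entries `1, …, i₀` (the operator `𝑗_{i₀}`):
delete the entry `1`, slide the empty box through the entries `≤ i₀`, decrement
those entries by one and place `i₀` in the final empty box. -/
def partialPromo (d w i₀ : ℕ) (E : ℕ → ℕ → ℕ) : ℕ → ℕ → ℕ := fun i j =>
  if d ≤ i ∨ w ≤ j then 0
  else if (i, j) = slidePath d w i₀ E i₀ then i₀
  else if slidePath d w i₀ E (i + j) = (i, j) then
    E (slidePath d w i₀ E (i + j + 1)).1 (slidePath d w i₀ E (i + j + 1)).2 - 1
  else if E i j ≤ i₀ then E i j - 1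
  else E i j

/-- Jeu de taquin promotion `𝑗` on fillings of the `d × w` rectangle. -/
def promo (d w : ℕ) (E : ℕ → ℕ → ℕ) : ℕ → ℕ → ℕ := partialPromo d w (d * w) E

/-- `evacAux d w i = 𝑗_1 ∘ 𝑗_2 ∘ ⋯ ∘ 𝑗_i`. -/
def evacAux (d w : ℕ) : ℕ → (ℕ → ℕ → ℕ) → (ℕ → ℕ → ℕ)
  | 0, E => E
  | i + 1, E => evacAux d w i (partialPromo d w (i + 1) E)

/-- Evacuation `𝑒 = 𝑗_1 ∘ 𝑗_2 ∘ ⋯ ∘ 𝑗_N` on fillings of the `d × w` rectangle. -/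
def evac (d w : ℕ) (E : ℕ → ℕ → ℕ) : ℕ → ℕ → ℕ := evacAux d w (d * w) E

/-- The `C_r`-fixed polynomial `z^m (z^r + h_1) ⋯ (z^r + h_ℓ)`. -/
def crPoly (r m ℓ : ℕ) (hs : Fin ℓ → ℂ) : Polynomial ℂ :=
  Polynomial.X ^ m * ∏ i : Fin ℓ, (Polynomial.X ^ r + Polynomial.C (hs i))

/-- The product `∏ (z^r + a_i)(z^r + a_i⁻¹)` of generic inverse pairs. -/
def pairsPoly (r t : ℕ) (a : Fin t → ℂ) : Polynomial ℂ :=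
  ∏ i : Fin t,
    ((Polynomial.X ^ r + Polynomial.C (a i)) * (Polynomial.X ^ r + Polynomial.C (a i)⁻¹))

/-- A `D_r`-fixed polynomial of type (1). -/
def type1poly (r m t : ℕ) (ε : ℂ) (a : Fin t → ℂ) : Polynomial ℂ :=
  Polynomial.X ^ m * (Polynomial.X ^ r + Polynomial.C ε) * pairsPoly r t a

/-- A `D_r`-fixed polynomial of type (2). -/
def type2poly (r m t : ℕ) (a : Fin t → ℂ) : Polynomial ℂ :=
  Polynomial.X ^ m * pairsPoly r t a

/-- A `D_r`-fixed polynomial of type (3). -/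
def type3poly (r m t : ℕ) (a : Fin t → ℂ) : Polynomial ℂ :=
  Polynomial.X ^ m * (Polynomial.X ^ r + 1) * (Polynomial.X ^ r - 1) * pairsPoly r t a

/-- `x` is an even-odd point: it has a basis each of whose members is an even or
an odd polynomial. -/
def IsEvenOddPoint (d : ℕ) (x : Submodule ℂ (Polynomial ℂ)) : Prop :=
  ∃ f : Fin d → Polynomial ℂ, LinearIndependent ℂ f ∧
    Submodule.span ℂ (Set.range f) = x ∧
    ∀ i, (f i).comp (-Polynomial.X) = f i ∨ (f i).comp (-Polynomial.X) = -(f i)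

/-- `x` is a real point: it has a basis of polynomials with real coefficients. -/
def IsRealPoint (d : ℕ) (x : Submodule ℂ (Polynomial ℂ)) : Prop :=
  ∃ f : Fin d → Polynomial ℂ, LinearIndependent ℂ f ∧
    Submodule.span ℂ (Set.range f) = x ∧
    ∀ i k, ((f i).coeff k).im = 0

/-- The Möbius action of a matrix on `ℂℙ¹ = ℂ ∪ {∞}` (modelled by `Option ℂ`,
with `none` playing the role of `∞`). -/
def mobP1 (M : Matrix (Fin 2) (Fin 2) ℂ) : Option ℂ → Option ℂ := fun p =>
  match p with
  | none => if M 1 0 = 0 then none else some (M 0 0 / M 1 0)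
  | some a =>
      if M 1 0 * a + M 1 1 = 0 then none
      else some ((M 0 0 * a + M 0 1) / (M 1 0 * a + M 1 1))

/-- The action of a matrix `φ` on `ℂ_{n-1}[z] `:
`(φf)(z) = (φ₂₁ z + φ₁₁)^{n-1} f((φ₂₂ z + φ₁₂)/(φ₂₁ z + φ₁₁))`. -/
def mobiusMap (n : ℕ) (M : Matrix (Fin 2) (Fin 2) ℂ) : Polynomial ℂ →ₗ[ℂ] Polynomial ℂ :=
  ∑ k ∈ Finset.range n, (Polynomial.lcoeff ℂ k).smulRight
    ((Polynomial.C (M 1 1) * Polynomial.X + Polynomial.C (M 0 1)) ^ k *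
     (Polynomial.C (M 1 0) * Polynomial.X + Polynomial.C (M 0 0)) ^ (n - 1 - k))

/-- The polynomial `∏_{a_i ≠ ∞} (z + a_i)` attached to a tuple of points of `ℂℙ¹`. -/
def rootsPoly (N : ℕ) (a : Fin N → Option ℂ) : Polynomial ℂ :=
  ∏ i : Fin N, (a i).elim 1 (fun c => Polynomial.X + Polynomial.C c)

/-- The eigenspace `M_k`: the span of the monomials `z^j`, `j < n`, `j ≡ k (mod r)`. -/
def eigSpace (n r : ℕ) (k : Fin r) : Submodule ℂ (Polynomial ℂ) :=
  Submodule.span ℂ {p : Polynomial ℂ | ∃ j : ℕ, j < n ∧ j % r = (k : ℕ) ∧ p = Polynomial.X ^ j}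

/-- The operator `c` on `ℂ_{n-1}[z]` with `c · z^k = ζ^{n-1-2k} z^k`, `ζ = e^{πi/r}`. -/
def cMap (n r : ℕ) : Polynomial ℂ →ₗ[ℂ] Polynomial ℂ :=
  (Complex.exp ((Real.pi : ℂ) * Complex.I / (r : ℂ))) ^ (n - 1) •
    (Polynomial.aeval
        (Polynomial.C (((Complex.exp ((Real.pi : ℂ) * Complex.I / (r : ℂ))) ^ 2)⁻¹) *
          Polynomial.X) :
      Polynomial ℂ →ₐ[ℂ] Polynomial ℂ).toLinearMap

/-- `μ` is obtained from `λ` by removing a single `r`-ribbon. -/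
def RibbonStep {d w : ℕ} (r : ℕ) (lam mu : PartitionIn d w) : Prop :=
  SubPartition mu lam ∧ IsRibbon r {p : ℕ × ℕ | InShape lam mu p.1 p.2}

/-- `λ` and `μ` have the same `r`-core: they are related by the equivalence
relation generated by removal of a single `r`-ribbon. -/
def RibbonEquiv {d w : ℕ} (r : ℕ) (lam mu : PartitionIn d w) : Prop :=
  Relation.EqvGen (fun a b => RibbonStep r a b) lam mu

/-- `κ` is an `r`-core: no `r`-ribbon can be removed from it. -/
def IsRCore {d w : ℕ} (r : ℕ) (kappa : PartitionIn d w) : Prop :=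
  ¬ ∃ mu : PartitionIn d w, RibbonStep r kappa mu

/-- The column set `J(λ) = {i - 1 + λ^{d+1-i} : 1 ≤ i ≤ d}` of the Plücker
coordinate `p_λ`, as a function of `i`. -/
def pluckerIndex {d w : ℕ} (lam : PartitionIn d w) (i : Fin d) : ℕ :=
  (i : ℕ) + lam.part (d - 1 - (i : ℕ))

/-- The Plücker coordinate `p_λ(x)` of `x` is nonzero (this does not depend on
the choice of basis of `x`). -/
def PluckerNonzero (d : ℕ) {w : ℕ} (lam : PartitionIn d w)
    (x : Submodule ℂ (Polynomial ℂ)) : Prop :=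
  ∃ f : Fin d → Polynomial ℂ, LinearIndependent ℂ f ∧
    Submodule.span ℂ (Set.range f) = x ∧
    Matrix.det (Matrix.of fun i i' : Fin d => (f i).coeff (pluckerIndex lam i')) ≠ 0

end


/-! ### Toggles on words of boxes -/
namespace DomRot

section grp
variable {G : Type*} [Group G] (t : ℕ → G)

/-- promotion on `n+1` letters -/
def pr : ℕ → G
  | 0 => 1
  | n + 1 => t n * pr n

/-- evacuation on `n+1` letters -/
def ev : ℕ → G
  | 0 => 1
  | n + 1 => ev n * pr t (n + 1)

/-- product of the even toggles -/
def dm : ℕ → G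
  | 0 => t 0
  | m + 1 => t (2 * m + 2) * dm m

theorem pr_comm (h2 : ∀ i j, i + 2 ≤ j → t i * t j = t j * t i)
    (n j : ℕ) (h : n + 1 ≤ j) : pr t n * t j = t j * pr t n := by
  induction n with
  | zero => simp [pr]
  | succ n ih =>
    rw [pr, mul_assoc, ih (by omega), ← mul_assoc, h2 n j (by omega), mul_assoc]

theorem ev_comm (h2 : ∀ i j, i + 2 ≤ j → t i * t j = t j * t i)
    (n j : ℕ) (h : n + 1 ≤ j) : ev t n * t j = t j * ev t n := by
  induction n with
  | zero => simp [ev]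
  | succ n ih =>
    rw [ev, mul_assoc, pr_comm t h2 _ _ h, ← mul_assoc, ih (by omega), mul_assoc]

theorem ev_sq (h1 : ∀ i, t i * t i = 1)
    (h2 : ∀ i j, i + 2 ≤ j → t i * t j = t j * t i) (n : ℕ) : ev t n * ev t n = 1 := by
  induction n using Nat.strong_induction_on with
  | _ n ih =>
    match n with
    | 0 => simp [ev]
    | 1 => simp [ev, pr, h1]
    | n + 2 =>
      have e1 := ih (n + 1) (by omega)
      have e0 := ih n (by omega)
      have hp : pr t (n + 1) = ev t n * ev t (n + 1) := by
        rw [ev, ← mul_assoc, e0, one_mul]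
      have c := ev_comm t h2 n (n + 1) (by omega)
      have : ev t (n + 2) = ev t (n + 1) * (t (n + 1) * (ev t n * ev t (n + 1))) := by
        rw [ev, pr, hp]
      rw [this]
      calc ev t (n + 1) * (t (n + 1) * (ev t n * ev t (n + 1))) *
            (ev t (n + 1) * (t (n + 1) * (ev t n * ev t (n + 1))))
          = ev t (n + 1) * t (n + 1) * ev t n * (ev t (n + 1) * ev t (n + 1)) * t (n + 1) *
              ev t n * ev t (n + 1) := by group
        _ = ev t (n + 1) * t (n + 1) * (ev t n * t (n + 1)) * ev t n * ev t (n + 1) := by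
            rw [e1]; group
        _ = ev t (n + 1) * (t (n + 1) * t (n + 1)) * (ev t n * ev t n) * ev t (n + 1) := by
            rw [c]; group
        _ = 1 := by rw [h1, e0]; simp [e1]

theorem ev_conj (h1 : ∀ i, t i * t i = 1)
    (h2 : ∀ i j, i + 2 ≤ j → t i * t j = t j * t i) (n : ℕ) :
    ev t (n + 2) = (pr t (n + 1))⁻¹ * (t (n + 1) * ev t n) * pr t (n + 1) := by
  have e1 := ev_sq t h1 h2 (n + 1)
  have e0 := ev_sq t h1 h2 n
  have c := ev_comm t h2 n (n + 1) (by omega)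
  have hi : (pr t (n + 1))⁻¹ = ev t (n + 1) * ev t n := by
    have hp : pr t (n + 1) = ev t n * ev t (n + 1) := by
      rw [ev, ← mul_assoc, e0, one_mul]
    rw [hp, mul_inv_rev, inv_eq_of_mul_eq_one_right e1, inv_eq_of_mul_eq_one_right e0]
  rw [hi, ← c, ev, pr]
  calc ev t (n + 1) * (t (n + 1) * pr t (n + 1))
      = ev t (n + 1) * 1 * (t (n + 1) * pr t (n + 1)) := by group
    _ = _ := by rw [← e0]; group

theorem ev_dm (h1 : ∀ i, t i * t i = 1)
    (h2 : ∀ i j, i + 2 ≤ j → t i * t j = t j * t i) (m : ℕ) : ∃ g ∈ Subgroup.closure {x | ∃ i < 2 * m + 1, x = t i},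
    ev t (2 * m + 1) = g⁻¹ * dm t m * g := by
  induction m with
  | zero => exact ⟨1, Subgroup.one_mem _, by simp [ev, pr, dm]⟩
  | succ m ih =>
    obtain ⟨h, hh, e⟩ := ih
    have hc : h * t (2 * m + 2) = t (2 * m + 2) * h := by
      refine Subgroup.closure_induction (p := fun x _ => x * t (2 * m + 2) = t (2 * m + 2) * x)
        ?_ ?_ ?_ ?_ hh
      · rintro x ⟨i, hi, rfl⟩
        exact h2 _ _ (by omega)
      · simp
      · intro x y _ _ hx hy
        rw [mul_assoc, hy, ← mul_assoc, hx, mul_assoc]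
      · intro x _ hx
        rw [inv_mul_eq_iff_eq_mul, ← mul_assoc, hx, mul_assoc, mul_inv_cancel, mul_one]
    have hp : ∀ n, n ≤ 2 * (m + 1) + 1 →
        pr t n ∈ Subgroup.closure {x | ∃ i < 2 * (m + 1) + 1, x = t i} := by
      intro n
      induction n with
      | zero => intro _; exact Subgroup.one_mem _
      | succ n ih =>
        intro hn
        exact Subgroup.mul_mem _ (Subgroup.subset_closure ⟨n, by omega, rfl⟩) (ih (by omega))
    refine ⟨h * pr t (2 * m + 1 + 1), Subgroup.mul_mem _ ?_ (hp _ (by omega)), ?_⟩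
    · refine Subgroup.closure_mono ?_ hh
      rintro x ⟨i, hi, rfl⟩
      exact ⟨i, by omega, rfl⟩
    · have hc' : t (2 * m + 2) * h⁻¹ = h⁻¹ * t (2 * m + 2) := by
        rw [eq_inv_mul_iff_mul_eq, ← mul_assoc, hc, mul_assoc, mul_inv_cancel, mul_one]
      have := ev_conj t h1 h2 (2 * m + 1)
      rw [show 2 * (m + 1) + 1 = 2 * m + 1 + 2 by ring, this, e, dm]
      rw [show t (2 * m + 1 + 1) * (h⁻¹ * dm t m * h) = h⁻¹ * (t (2 * m + 2) * dm t m) * h by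
        rw [← mul_assoc, ← mul_assoc, hc']; group]
      group

end grp

/-- content of a box -/
def ct (p : ℕ × ℕ) : ℤ := (p.2 : ℤ) - (p.1 : ℤ)

/-- infinite words of boxes -/
abbrev Wd := ℕ → ℕ × ℕ

/-- exchange the letters in positions `i`, `i+1` -/
def sw (i : ℕ) (b : Wd) : Wd := fun k => if k = i then b (i + 1) else if k = i + 1 then b i else b k

/-- toggle -/
def tg (i : ℕ) (b : Wd) : Wd :=
  if ct (b i) + 2 ≤ ct (b (i + 1)) ∨ ct (b (i + 1)) + 2 ≤ ct (b i) then sw i b else b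

/-- elementary dual equivalence in positions `i`, `i+1`, `i+2` -/
def dk (i : ℕ) (b : Wd) : Wd :=
  if (ct (b (i + 1)) < ct (b i) ∧ ct (b i) < ct (b (i + 2))) ∨
     (ct (b (i + 2)) < ct (b i) ∧ ct (b i) < ct (b (i + 1))) then sw (i + 1) b
  else if (ct (b i) < ct (b (i + 2)) ∧ ct (b (i + 2)) < ct (b (i + 1))) ∨
     (ct (b (i + 1)) < ct (b (i + 2)) ∧ ct (b (i + 2)) < ct (b i)) then sw i b
  else b

theorem sw_l (i : ℕ) (b : Wd) : sw i b i = b (i + 1) := by simp [sw]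
theorem sw_r (i : ℕ) (b : Wd) : sw i b (i + 1) = b i := by simp [sw]
theorem sw_o (i k : ℕ) (b : Wd) (h : k ≠ i) (h' : k ≠ i + 1) : sw i b k = b k := by
  simp [sw, h, h']
theorem sw_sw (i : ℕ) (b : Wd) : sw i (sw i b) = b := by
  funext k
  by_cases h : k = i
  · subst h; simp [sw]
  · by_cases h' : k = i + 1
    · subst h'; simp [sw]
    · simp [sw, h, h']

theorem tg_tg (i : ℕ) (b : Wd) : tg i (tg i b) = b := by
  unfold tg
  by_cases h : ct (b i) + 2 ≤ ct (b (i + 1)) ∨ ct (b (i + 1)) + 2 ≤ ct (b i)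
  · rw [if_pos h, if_pos (by rw [sw_l, sw_r]; tauto), sw_sw]
  · rw [if_neg h, if_neg h]

theorem sw_comm (i j : ℕ) (b : Wd) (h : i + 2 ≤ j) : sw i (sw j b) = sw j (sw i b) := by
  funext k
  simp only [sw]
  split_ifs <;> first | rfl | omega

theorem tg_o (i k : ℕ) (b : Wd) (h : k ≠ i) (h' : k ≠ i + 1) : tg i b k = b k := by
  unfold tg; split_ifs
  · exact sw_o _ _ _ h h'
  · rfl

theorem dk_o (i k : ℕ) (b : Wd) (h : k ≠ i) (h' : k ≠ i + 1) (h'' : k ≠ i + 2) :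
    dk i b k = b k := by
  unfold dk; split_ifs
  · exact sw_o _ _ _ h' h''
  · exact sw_o _ _ _ h h'
  · rfl

theorem tg_sw_comm (i j : ℕ) (b : Wd) (h : i + 2 ≤ j ∨ j + 2 ≤ i) :
    tg i (sw j b) = sw j (tg i b) := by
  unfold tg
  rw [sw_o j i _ (by omega) (by omega), sw_o j (i + 1) _ (by omega) (by omega)]
  split_ifs
  · rcases h with h | h
    · exact sw_comm _ _ _ h
    · exact (sw_comm _ _ _ h).symm
  · rfl

theorem tg_comm (i j : ℕ) (b : Wd) (h : i + 2 ≤ j) : tg i (tg j b) = tg j (tg i b) := by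
  conv_rhs => rw [tg, tg_o i j _ (by omega) (by omega), tg_o i (j + 1) _ (by omega) (by omega)]
  rw [tg.eq_def j b]
  split_ifs
  · exact tg_sw_comm _ _ _ (Or.inl h)
  · rfl

theorem tg_dk_comm (i j : ℕ) (b : Wd) (h : i + 2 ≤ j ∨ j + 3 ≤ i) :
    tg i (dk j b) = dk j (tg i b) := by
  conv_rhs => rw [dk, tg_o i j _ (by omega) (by omega), tg_o i (j + 1) _ (by omega) (by omega),
    tg_o i (j + 2) _ (by omega) (by omega)]
  rw [dk.eq_def j b]
  split_ifs
  · exact tg_sw_comm _ _ _ (by omega)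
  · exact tg_sw_comm _ _ _ (by omega)
  · rfl

theorem dk_dk (i : ℕ) (b : Wd) : dk i (dk i b) = b := by
  have a1 := sw_o (i + 1) i b (by omega) (by omega)
  have a2 := sw_l (i + 1) b
  have a3 := sw_r (i + 1) b
  have b1 := sw_l i b
  have b2 := sw_r i b
  have b3 := sw_o i (i + 2) b (by omega) (by omega)
  simp only [add_assoc, Nat.reduceAdd] at a1 a2 a3 b1 b2 b3
  rw [dk.eq_def i b]
  split_ifs with h h'
  · rw [dk, a1, a2, a3, if_pos (by tauto), sw_sw]
  · rw [dk, b1, b2, b3, if_neg (by omega), if_pos (by omega), sw_sw]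
  · rw [dk, if_neg h, if_neg h']

/-- toggles as permutations -/
def tP (i : ℕ) : Equiv.Perm Wd := Function.Involutive.toPerm (tg i) (tg_tg i)

theorem tP_apply (i : ℕ) (b : Wd) : tP i b = tg i b := rfl

theorem tP_sq (i : ℕ) : tP i * tP i = 1 := by
  ext1 b; simp [tP_apply, tg_tg]

theorem tP_comm (i j : ℕ) (h : i + 2 ≤ j) : tP i * tP j = tP j * tP i := by
  ext1 b; simp [tP_apply, tg_comm i j b h]

/-- local validity of a word in the window of letters `< N` -/
structure Val (N : ℕ) (b : Wd) : Prop where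
  v1 : ∀ i, i + 1 < N → ct (b i) ≠ ct (b (i + 1))
  v2 : ∀ i, i + 2 < N → ct (b i) ≠ ct (b (i + 2))
  v3 : ∀ i, i + 3 < N → ct (b i) = ct (b (i + 3)) →
    (ct (b (i + 1)) = ct (b i) + 1 ∧ ct (b (i + 2)) = ct (b i) - 1) ∨
    (ct (b (i + 1)) = ct (b i) - 1 ∧ ct (b (i + 2)) = ct (b i) + 1)

/-- window of four letters -/
def win (i : ℕ) (b : Wd) : (ℕ × ℕ) × (ℕ × ℕ) × (ℕ × ℕ) × (ℕ × ℕ) :=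
  (b i, b (i + 1), b (i + 2), b (i + 3))

section four
variable {α : Type*} (c : α → ℤ)

/-- toggle of the first two letters -/
def T0 : α × α × α × α → α × α × α × α := fun (p, x, y, z) =>
  if c p + 2 ≤ c x ∨ c x + 2 ≤ c p then (x, p, y, z) else (p, x, y, z)
/-- toggle of the middle two letters -/
def T1 : α × α × α × α → α × α × α × α := fun (p, x, y, z) =>
  if c x + 2 ≤ c y ∨ c y + 2 ≤ c x then (p, y, x, z) else (p, x, y, z)
/-- toggle of the last two letters -/
def T2 : α × α × α × α → α × α × α × α := fun (p, x, y, z) =>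
  if c y + 2 ≤ c z ∨ c z + 2 ≤ c y then (p, x, z, y) else (p, x, y, z)
/-- dual equivalence on the first three letters -/
def D0 : α × α × α × α → α × α × α × α := fun (x, y, z, p) =>
  if (c y < c x ∧ c x < c z) ∨ (c z < c x ∧ c x < c y) then (x, z, y, p)
  else if (c x < c z ∧ c z < c y) ∨ (c y < c z ∧ c z < c x) then (y, x, z, p)
  else (x, y, z, p)
/-- dual equivalence on the last three letters -/
def D1 : α × α × α × α → α × α × α × α := fun (p, x, y, z) =>
  if (c y < c x ∧ c x < c z) ∨ (c z < c x ∧ c x < c y) then (p, x, z, y)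
  else if (c x < c z ∧ c z < c y) ∨ (c y < c z ∧ c z < c x) then (p, y, x, z)
  else (p, x, y, z)

set_option maxHeartbeats 4000000 in
theorem four (p x y z : α) (p1 : c p ≠ c x) (p2 : c x ≠ c y) (p3 : c y ≠ c z)
    (q1 : c p ≠ c y) (q2 : c x ≠ c z)
    (r : c p = c z → (c x = c p + 1 ∧ c y = c p - 1) ∨ (c x = c p - 1 ∧ c y = c p + 1)) :
    T2 c (T1 c (T0 c (D1 c (p, x, y, z)))) = D0 c (T2 c (T1 c (T0 c (p, x, y, z)))) := by
  simp only [D1]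
  split_ifs <;> simp only [T0] <;> split_ifs <;> (try (exfalso; omega)) <;>
  simp only [T1] <;> split_ifs <;> (try (exfalso; omega)) <;>
  simp only [T2] <;> split_ifs <;> (try (exfalso; omega)) <;>
  simp only [D0] <;> split_ifs <;> (try (exfalso; omega)) <;> rfl

end four

theorem win_tg0 (i : ℕ) (b : Wd) : win i (tg i b) = T0 ct (win i b) := by
  by_cases h : ct (b i) + 2 ≤ ct (b (i + 1)) ∨ ct (b (i + 1)) + 2 ≤ ct (b i)
  · rw [tg, if_pos h]
    refine Eq.trans ?_ (if_pos h).symm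
    simp [win, sw]
    try omega
  · rw [tg, if_neg h]
    exact (if_neg h).symm
theorem win_tg1 (i : ℕ) (b : Wd) : win i (tg (i + 1) b) = T1 ct (win i b) := by
  by_cases h : ct (b (i + 1)) + 2 ≤ ct (b (i + 2)) ∨ ct (b (i + 2)) + 2 ≤ ct (b (i + 1))
  · rw [tg, if_pos h]
    refine Eq.trans ?_ (if_pos h).symm
    simp [win, sw]
    try omega
  · rw [tg, if_neg h]
    exact (if_neg h).symm
theorem win_tg2 (i : ℕ) (b : Wd) : win i (tg (i + 2) b) = T2 ct (win i b) := by
  by_cases h : ct (b (i + 2)) + 2 ≤ ct (b (i + 3)) ∨ ct (b (i + 3)) + 2 ≤ ct (b (i + 2))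
  · rw [tg, if_pos h]
    refine Eq.trans ?_ (if_pos h).symm
    simp [win, sw]
    try omega
  · rw [tg, if_neg h]
    exact (if_neg h).symm
theorem win_dk0 (i : ℕ) (b : Wd) : win i (dk i b) = D0 ct (win i b) := by
  by_cases h : (ct (b (i + 1)) < ct (b i) ∧ ct (b i) < ct (b (i + 2))) ∨ (ct (b (i + 2)) < ct (b i) ∧ ct (b i) < ct (b (i + 1)))
  · rw [dk, if_pos h]
    refine Eq.trans ?_ (if_pos h).symm
    simp [win, sw]
    try omega
  · by_cases h' : (ct (b i) < ct (b (i + 2)) ∧ ct (b (i + 2)) < ct (b (i + 1))) ∨ (ct (b (i + 1)) < ct (b (i + 2)) ∧ ct (b (i + 2)) < ct (b i))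
    · rw [dk, if_neg h, if_pos h']
      refine Eq.trans ?_ ((if_neg h).trans (if_pos h')).symm
      simp [win, sw]
      try omega
    · rw [dk, if_neg h, if_neg h']
      exact ((if_neg h).trans (if_neg h')).symm
theorem win_dk1 (i : ℕ) (b : Wd) : win i (dk (i + 1) b) = D1 ct (win i b) := by
  by_cases h : (ct (b (i + 2)) < ct (b (i + 1)) ∧ ct (b (i + 1)) < ct (b (i + 3))) ∨ (ct (b (i + 3)) < ct (b (i + 1)) ∧ ct (b (i + 1)) < ct (b (i + 2)))
  · rw [dk, if_pos h]
    refine Eq.trans ?_ (if_pos h).symm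
    simp [win, sw]
    rw [if_neg (by omega), if_neg (by omega)]
  · by_cases h' : (ct (b (i + 1)) < ct (b (i + 3)) ∧ ct (b (i + 3)) < ct (b (i + 2))) ∨ (ct (b (i + 2)) < ct (b (i + 3)) ∧ ct (b (i + 3)) < ct (b (i + 1)))
    · rw [dk, if_neg h, if_pos h']
      refine Eq.trans ?_ ((if_neg h).trans (if_pos h')).symm
      simp [win, sw]
      try omega
    · rw [dk, if_neg h, if_neg h']
      exact ((if_neg h).trans (if_neg h')).symm

theorem window4 {a b : Wd} (i : ℕ) (h : ∀ k, k ≠ i → k ≠ i + 1 → k ≠ i + 2 → k ≠ i + 3 → a k = b k)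
    (hw : win i a = win i b) : a = b := by
  simp only [win, Prod.mk.injEq] at hw
  funext k
  by_cases e0 : k = i
  · rw [e0]; exact hw.1
  by_cases e1 : k = i + 1
  · rw [e1]; exact hw.2.1
  by_cases e2 : k = i + 2
  · rw [e2]; exact hw.2.2.1
  by_cases e3 : k = i + 3
  · rw [e3]; exact hw.2.2.2
  exact h k e0 e1 e2 e3

theorem local4 (N i : ℕ) (b : Wd) (hb : Val N b) (hi : i + 3 < N) :
    tg (i + 2) (tg (i + 1) (tg i (dk (i + 1) b))) =
      dk i (tg (i + 2) (tg (i + 1) (tg i b))) := by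
  refine window4 i ?_ ?_
  · intro k k0 k1 k2 k3
    rw [tg_o _ _ _ (by omega) (by omega), tg_o _ _ _ (by omega) (by omega),
      tg_o _ _ _ (by omega) (by omega), dk_o _ _ _ (by omega) (by omega) (by omega),
      dk_o _ _ _ (by omega) (by omega) (by omega), tg_o _ _ _ (by omega) (by omega),
      tg_o _ _ _ (by omega) (by omega), tg_o _ _ _ (by omega) (by omega)]
  · rw [win_tg2, win_tg1, win_tg0, win_dk1, win_dk0, win_tg2, win_tg1, win_tg0]
    exact four ct _ _ _ _ (hb.v1 i (by omega)) (hb.v1 (i + 1) (by omega))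
      (hb.v1 (i + 2) (by omega)) (hb.v2 i (by omega)) (hb.v2 (i + 1) (by omega)) (hb.v3 i hi)

end DomRot

namespace DomRot

/-- linear extensions of the rectangle, as words of boxes -/
structure Lin (d w : ℕ) (b : Wd) : Prop where
  out : ∀ k, d * w ≤ k → b k = (0, 0)
  mem : ∀ k, k < d * w → (b k).1 < d ∧ (b k).2 < w
  surj : ∀ r s, r < d → s < w → ∃ k, k < d * w ∧ b k = (r, s)
  mono : ∀ i j, i < d * w → j < d * w → (b i).1 ≤ (b j).1 → (b i).2 ≤ (b j).2 → i ≤ j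

variable {d w : ℕ} {b : Wd}

theorem Lin.inj (h : Lin d w b) {i j : ℕ} (hi : i < d * w) (hj : j < d * w) (e : b i = b j) :
    i = j :=
  le_antisymm (h.mono i j hi hj (by rw [e]) (by rw [e])) (h.mono j i hj hi (by rw [e]) (by rw [e]))

theorem Lin.same (h : Lin d w b) {i j : ℕ} (hij : i < j) (hj : j < d * w)
    (e : ct (b i) = ct (b j)) :
    ∃ u v, i < u ∧ u < j ∧ i < v ∧ v < j ∧ u ≠ v ∧ ct (b u) = ct (b i) - 1 ∧
      ct (b v) = ct (b i) + 1 := by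
  have hi : i < d * w := by omega
  have m1 := h.mem i hi
  have m2 := h.mem j hj
  have hlt : (b i).1 < (b j).1 := by
    by_contra hc
    have := h.mono j i hj hi (by omega) (by unfold ct at e; omega)
    omega
  have hlt2 : (b i).2 < (b j).2 := by unfold ct at e; omega
  obtain ⟨u, hu, eu⟩ := h.surj ((b i).1 + 1) (b i).2 (by omega) (by omega)
  obtain ⟨v, hv, e2⟩ := h.surj (b i).1 ((b i).2 + 1) (by omega) (by omega)
  have a1 := h.mono i u hi hu (by rw [eu]; simp) (by rw [eu])
  have a2 := h.mono u j hu hj (by rw [eu]; exact hlt) (by rw [eu]; exact hlt2.le)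
  have a3 := h.mono i v hi hv (by rw [e2]) (by rw [e2]; simp)
  have a4 := h.mono v j hv hj (by rw [e2]; exact hlt.le) (by rw [e2]; exact hlt2)
  have c1 : ct (b u) = ct (b i) - 1 := by rw [eu]; simp [ct]; ring
  have c2 : ct (b v) = ct (b i) + 1 := by rw [e2]; simp [ct]; ring
  refine ⟨u, v, ?_, ?_, ?_, ?_, ?_, c1, c2⟩
  · rcases a1.lt_or_eq with q | q
    · exact q
    · rw [← q] at c1; omega
  · rcases a2.lt_or_eq with q | q
    · exact q
    · rw [q] at c1; omega
  · rcases a3.lt_or_eq with q | q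
    · exact q
    · rw [← q] at c2; omega
  · rcases a4.lt_or_eq with q | q
    · exact q
    · rw [q] at c2; omega
  · intro q; rw [q] at c1; omega

theorem Lin.val (h : Lin d w b) : Val (d * w) b := by
  refine ⟨?_, ?_, ?_⟩
  · intro i hi e
    obtain ⟨u, v, h1, h2, h3, h4, h5, -⟩ := h.same (by omega) hi e
    omega
  · intro i hi e
    obtain ⟨u, v, h1, h2, h3, h4, h5, -⟩ := h.same (by omega) hi e
    omega
  · intro i hi e
    obtain ⟨u, v, h1, h2, h3, h4, h5, c1, c2⟩ := h.same (by omega) hi e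
    have : (u = i + 1 ∧ v = i + 2) ∨ (u = i + 2 ∧ v = i + 1) := by omega
    rcases this with ⟨rfl, rfl⟩ | ⟨rfl, rfl⟩
    · right; exact ⟨c1, c2⟩
    · left; exact ⟨c2, c1⟩

theorem Lin.adj (h : Lin d w b) {i : ℕ} (hi : i + 1 < d * w) (e1 : (b i).1 ≤ (b (i + 1)).1)
    (e2 : (b i).2 ≤ (b (i + 1)).2) :
    ((b (i + 1)).1 = (b i).1 + 1 ∧ (b (i + 1)).2 = (b i).2) ∨
    ((b (i + 1)).1 = (b i).1 ∧ (b (i + 1)).2 = (b i).2 + 1) := by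
  have m2 := h.mem (i + 1) hi
  have hne : ¬ ((b (i + 1)).1 ≤ (b i).1 ∧ (b (i + 1)).2 ≤ (b i).2) := by
    rintro ⟨q1, q2⟩
    have := h.mono (i + 1) i hi (by omega) q1 q2
    omega
  by_cases q : (b i).1 < (b (i + 1)).1
  · left
    obtain ⟨u, hu, eu⟩ := h.surj ((b i).1 + 1) (b i).2 (by omega) (by omega)
    have a1 := h.mono i u (by omega) hu (by rw [eu]; simp) (by rw [eu])
    have a2 := h.mono u (i + 1) hu hi (by rw [eu]; exact q) (by rw [eu]; exact e2)
    have : u ≠ i := by rintro rfl; have := congrArg Prod.fst eu; simp at this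
    have : u = i + 1 := by omega
    subst this
    rw [eu]; simp
  · right
    obtain ⟨u, hu, eu⟩ := h.surj (b i).1 ((b i).2 + 1) (by omega) (by omega)
    have a1 := h.mono i u (by omega) hu (by rw [eu]) (by rw [eu]; simp)
    have a2 := h.mono u (i + 1) hu hi (by rw [eu]; exact e1) (by rw [eu]; simp; omega)
    have : u ≠ i := by rintro rfl; have := congrArg Prod.snd eu; simp at this
    have : u = i + 1 := by omega
    subst this
    rw [eu]; simp

theorem sw_eq (i : ℕ) (b : Wd) (k : ℕ) :
    sw i b k = b (if k = i then i + 1 else if k = i + 1 then i else k) := by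
  unfold sw; split_ifs <;> rfl

theorem Lin.sw (h : Lin d w b) {i : ℕ} (hi : i + 1 < d * w)
    (hc : ¬ ((b i).1 ≤ (b (i + 1)).1 ∧ (b i).2 ≤ (b (i + 1)).2)) : Lin d w (sw i b) := by
  refine ⟨?_, ?_, ?_, ?_⟩
  · intro k hk; rw [sw_o _ _ _ (by omega) (by omega)]; exact h.out k hk
  · intro k hk; rw [sw_eq]; apply h.mem; split_ifs <;> omega
  · intro r s hr hs
    obtain ⟨k, hk, e⟩ := h.surj r s hr hs
    refine ⟨if k = i then i + 1 else if k = i + 1 then i else k, by split_ifs <;> omega, ?_⟩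
    rw [sw_eq, ← e]; congr 1; split_ifs <;> omega
  · intro k l hk hl
    rw [sw_eq, sw_eq]
    intro e1 e2
    have := h.mono _ _ (by split_ifs <;> omega) (by split_ifs <;> omega) e1 e2
    by_cases q : k = i + 1 ∧ l = i
    · exfalso
      obtain ⟨rfl, rfl⟩ := q
      simp at e1 e2
      exact hc ⟨e1, e2⟩
    · split_ifs at this <;> omega

theorem Lin.sw_far (h : Lin d w b) {i : ℕ} (hi : i + 1 < d * w)
    (hc : ct (b i) + 2 ≤ ct (b (i + 1)) ∨ ct (b (i + 1)) + 2 ≤ ct (b i)) :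
    Lin d w (DomRot.sw i b) := by
  refine h.sw hi ?_
  rintro ⟨e1, e2⟩
  have := h.adj hi e1 e2
  unfold ct at hc
  omega

theorem Lin.tg (h : Lin d w b) {i : ℕ} (hi : i + 1 < d * w) : Lin d w (tg i b) := by
  unfold DomRot.tg
  split_ifs with hc
  · exact h.sw_far hi hc
  · exact h

theorem Lin.dk (h : Lin d w b) {i : ℕ} (hi : i + 2 < d * w) : Lin d w (dk i b) := by
  unfold DomRot.dk
  split_ifs with h1 h2
  · exact h.sw_far (by omega) (by simp only [add_assoc, Nat.reduceAdd]; omega)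
  · exact h.sw_far (by omega) (by omega)
  · exact h

theorem Lin.pr (h : Lin d w b) {n : ℕ} (hn : n + 1 ≤ d * w) : Lin d w (pr tP n b) := by
  induction n with
  | zero => exact h
  | succ n ih => exact (ih (by omega)).tg (by omega)

theorem Lin.ev (h : Lin d w b) {n : ℕ} (hn : n + 1 ≤ d * w) : Lin d w (ev tP n b) := by
  induction n generalizing b with
  | zero => exact h
  | succ n ih =>
    rw [DomRot.ev]
    exact ih (h.pr hn) (by omega)

theorem ev_ev (n : ℕ) (b : Wd) : ev tP n (ev tP n b) = b := by
  have := ev_sq tP tP_sq tP_comm n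
  rw [← Equiv.Perm.mul_apply, this]; rfl

theorem pr_dk_lo (n i : ℕ) (h : n ≤ i) (b : Wd) :
    pr tP n (dk (i + 1) b) = dk (i + 1) (pr tP n b) := by
  induction n with
  | zero => rfl
  | succ n ih =>
    rw [pr, Equiv.Perm.mul_apply, Equiv.Perm.mul_apply, ih (by omega), tP_apply, tP_apply,
      tg_dk_comm _ _ _ (by omega)]

theorem pr_dk (h : Lin d w b) (i k : ℕ) (hn : i + 3 + k + 1 ≤ d * w) :
    pr tP (i + 3 + k) (dk (i + 1) b) = dk i (pr tP (i + 3 + k) b) := by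
  induction k with
  | zero =>
    simp only [add_zero]
    rw [pr, pr, pr]
    simp only [Equiv.Perm.mul_apply, tP_apply]
    rw [pr_dk_lo _ _ le_rfl]
    exact local4 (d * w) i _ (h.pr (by omega)).val (by omega)
  | succ k ih =>
    rw [← add_assoc, pr, Equiv.Perm.mul_apply, Equiv.Perm.mul_apply, ih (by omega), tP_apply,
      tP_apply, tg_dk_comm _ _ _ (by omega)]

theorem three {α : Type*} (c : α → ℤ) (U E : α × α × α × α → α × α × α × α)
    (hU : U = T0 c) (hE : E = D0 c) (p x y z : α) (p1 : c p ≠ c x) (p2 : c x ≠ c y)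
    (q1 : c p ≠ c y) (hx : c x = c p + 1 ∨ c x = c p - 1)
    (hy : c y = c p + 1 ∨ c y = c p - 1 ∨ c y = c x + 1 ∨ c y = c x - 1) :
    U (T1 c (T0 c (D0 c (p, x, y, z)))) = E (U (T1 c (T0 c (p, x, y, z)))) := by
  simp only [D0]
  split_ifs <;> simp only [T0] <;> split_ifs <;> (try (exfalso; omega)) <;>
  simp only [T1] <;> split_ifs <;> (try (exfalso; omega)) <;>
  simp only [hU, T0] <;> split_ifs <;> (try (exfalso; omega)) <;>
  simp only [hE, D0] <;> split_ifs <;> (try (exfalso; omega)) <;> rfl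

theorem Lin.zero (h : Lin d w b) (hN : 0 < d * w) : b 0 = (0, 0) := by
  have hd : 0 < d := Nat.pos_of_mul_pos_right hN
  have hw : 0 < w := Nat.pos_of_mul_pos_left hN
  obtain ⟨k, hk, e⟩ := h.surj 0 0 hd hw
  have := h.mono k 0 hk hN (by rw [e]; simp) (by rw [e]; simp)
  rw [← e]; congr 1; omega

theorem Lin.start (h : Lin d w b) (hN : 2 < d * w) :
    (ct (b 1) = ct (b 0) + 1 ∨ ct (b 1) = ct (b 0) - 1) ∧
    (ct (b 2) = ct (b 0) + 1 ∨ ct (b 2) = ct (b 0) - 1 ∨ ct (b 2) = ct (b 1) + 1 ∨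
      ct (b 2) = ct (b 1) - 1) := by
  have z := h.zero (by omega)
  constructor
  · have := h.adj (i := 0) (by omega) (by rw [z]; simp) (by rw [z]; simp)
    unfold ct; simp only [zero_add] at this; omega
  · have m2 := h.mem 2 hN
    have hne : ¬ ((b 2).1 = 0 ∧ (b 2).2 = 0) := by
      rintro ⟨q1, q2⟩
      have := h.inj (i := 2) (j := 0) hN (by omega) (by rw [z]; exact Prod.ext q1 q2)
      omega
    by_cases q : 0 < (b 2).1
    · obtain ⟨u, hu, eu⟩ := h.surj ((b 2).1 - 1) (b 2).2 (by omega) (by omega)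
      have a1 := h.mono u 2 hu hN (by rw [eu]; simp) (by rw [eu])
      have e : ct (b u) = ct (b 2) + 1 := by rw [eu]; unfold ct; simp only; omega
      have : u = 0 ∨ u = 1 ∨ u = 2 := by omega
      rcases this with rfl | rfl | rfl <;> omega
    · obtain ⟨u, hu, eu⟩ := h.surj (b 2).1 ((b 2).2 - 1) (by omega) (by omega)
      have a1 := h.mono u 2 hu hN (by rw [eu]) (by rw [eu]; simp)
      have e : ct (b u) = ct (b 2) - 1 := by rw [eu]; unfold ct; simp only; omega
      have : u = 0 ∨ u = 1 ∨ u = 2 := by omega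
      rcases this with rfl | rfl | rfl <;> omega

theorem ev_dk (n : ℕ) : ∀ i, i + 2 ≤ n → n + 1 ≤ d * w → ∀ b, Lin d w b →
    ev tP n (dk i b) = dk (n - 2 - i) (ev tP n b) := by
  induction n with
  | zero => intro i hi; omega
  | succ n ih =>
    intro i hi hn b h
    have key : ∀ i, i + 3 ≤ n + 1 → ∀ b, Lin d w b →
        ev tP (n + 1) (dk (i + 1) b) = dk (n + 1 - 2 - (i + 1)) (ev tP (n + 1) b) := by
      intro i hi b h
      obtain ⟨k, hk⟩ := Nat.exists_eq_add_of_le hi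
      rw [ev, Equiv.Perm.mul_apply, Equiv.Perm.mul_apply, hk, pr_dk h i k (by omega), ← hk,
        ih i (by omega) (by omega) _ (h.pr hn)]
      congr 1; omega
    rcases i with _ | i
    · by_cases hn1 : n = 1
      · subst hn1
        simp only [ev, pr, Equiv.Perm.mul_apply, tP_apply, Equiv.Perm.one_apply]
        refine window4 0 ?_ ?_
        · intro k k0 k1 k2 k3
          simp only [Nat.reduceAdd, Nat.reduceSub]
          rw [tg_o _ _ _ (by omega) (by omega), tg_o _ _ _ (by omega) (by omega),
            tg_o _ _ _ (by omega) (by omega), dk_o _ _ _ (by omega) (by omega) (by omega),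
            dk_o _ _ _ (by omega) (by omega) (by omega), tg_o _ _ _ (by omega) (by omega),
            tg_o _ _ _ (by omega) (by omega), tg_o _ _ _ (by omega) (by omega)]
        · have w1 := win_tg1 0
          simp only [zero_add] at w1
          simp only [Nat.reduceAdd, Nat.reduceSub]
          rw [win_tg0, w1, win_tg0, win_dk0, win_dk0, win_tg0, w1, win_tg0]
          exact three ct _ _ rfl rfl _ _ _ _ (h.val.v1 0 (by omega)) (h.val.v1 1 (by omega))
            (h.val.v2 0 (by omega)) (h.start (by omega)).1 (h.start (by omega)).2
      · have e := key (n - 2) (by omega) (ev tP (n + 1) b) (h.ev hn)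
        rw [ev_ev] at e
        have e' := congrArg (fun x => ev tP (n + 1) x) e
        simp only [ev_ev] at e'
        rw [show n + 1 - 2 - (n - 2 + 1) = 0 by omega] at e'
        rw [← e']
        congr 1; omega
    · exact key i (by omega) b h

/-- descent -/
def ds (i : ℕ) (b : Wd) : Prop := ct (b (i + 1)) < ct (b i)

theorem pr_ds (h : Lin d w b) (i k : ℕ) (hn : i + 2 + k + 1 ≤ d * w) :
    ds i (pr tP (i + 2 + k) b) ↔ ds (i + 1) b := by
  induction k with
  | zero =>
    simp only [add_zero]
    rw [pr, pr]
    simp only [Equiv.Perm.mul_apply, tP_apply]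
    have lo : ∀ n, n ≤ i → ∀ k, n < k → pr tP n b k = b k := by
      intro n
      induction n with
      | zero => intro _ k _; rfl
      | succ n ih =>
        intro hn k hk
        rw [pr, Equiv.Perm.mul_apply, tP_apply, tg_o _ _ _ (by omega) (by omega)]
        exact ih (by omega) k (by omega)
    set a := pr tP i b with ha
    have hv := (h.pr (n := i) (by omega)).val
    rw [← ha] at hv
    have e1 : b (i + 1) = a (i + 1) := (lo i le_rfl _ (by omega)).symm
    have e2 : b (i + 2) = a (i + 2) := (lo i le_rfl _ (by omega)).symm
    have p1 := hv.v1 i (by omega)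
    have p2 := hv.v1 (i + 1) (by omega)
    have q1 := hv.v2 i (by omega)
    have ww : win i (tg (i + 1) (tg i a)) = T1 ct (T0 ct (win i a)) := by rw [win_tg1, win_tg0]
    have w1 := congrArg (fun v => v.1) ww
    have w2 := congrArg (fun v => v.2.1) ww
    simp only [win] at w1 w2
    simp only [ds, add_assoc, Nat.reduceAdd] at *
    rw [w1, w2, e1, e2]
    generalize a i = p at *
    generalize a (i + 1) = x at *
    generalize a (i + 2) = y at *
    simp only [T0]
    split_ifs <;> simp only [T1] <;> split_ifs <;> simp only <;> omega
  | succ k ih =>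
    rw [← ih (by omega), ← add_assoc, pr, Equiv.Perm.mul_apply, tP_apply, ds, ds,
      tg_o _ _ _ (by omega) (by omega), tg_o _ _ _ (by omega) (by omega)]

theorem ev_ds (n : ℕ) : ∀ i, i + 1 ≤ n → n + 1 ≤ d * w → ∀ b, Lin d w b →
    (ds (n - 1 - i) (ev tP n b) ↔ ds i b) := by
  induction n with
  | zero => intro i hi; omega
  | succ n ih =>
    intro i hi hn b h
    have key : ∀ i, i + 2 ≤ n + 1 → ∀ b, Lin d w b →
        (ds (n + 1 - 1 - (i + 1)) (ev tP (n + 1) b) ↔ ds (i + 1) b) := by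
      intro i hi b h
      obtain ⟨k, hk⟩ := Nat.exists_eq_add_of_le hi
      have := ih i (by omega) (by omega) _ (h.pr hn)
      rw [ev, Equiv.Perm.mul_apply, show n + 1 - 1 - (i + 1) = n - 1 - i by omega, this, hk,
        pr_ds h i k (by omega)]
    rcases i with _ | i
    · by_cases hn1 : n = 0
      · subst hn1
        simp only [ev, pr, Equiv.Perm.mul_apply, tP_apply, Equiv.Perm.one_apply]
        have z := h.zero (by omega)
        have := h.adj (i := 0) (by omega) (by rw [z]; simp) (by rw [z]; simp)
        rw [tg, if_neg]
        unfold ct; omega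
      · have e := key (n - 1) (by omega) (ev tP (n + 1) b) (h.ev hn)
        rw [ev_ev, show n + 1 - 1 - (n - 1 + 1) = 0 by omega,
          show n - 1 + 1 = n by omega] at e
        rw [e]; rfl
    · exact key i (by omega) b h

end DomRot

namespace DomRot

variable {d w : ℕ} {b : Wd}

/-- rotation of a word -/
def rv (d w : ℕ) (b : Wd) : Wd := fun k =>
  if k < d * w then (d - 1 - (b (d * w - 1 - k)).1, w - 1 - (b (d * w - 1 - k)).2) else (0, 0)

theorem rv_in {k : ℕ} (hk : k < d * w) :
    rv d w b k = (d - 1 - (b (d * w - 1 - k)).1, w - 1 - (b (d * w - 1 - k)).2) := if_pos hk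

theorem Lin.rv (h : Lin d w b) : Lin d w (rv d w b) := by
  refine ⟨?_, ?_, ?_, ?_⟩
  · intro k hk; exact if_neg (by omega)
  · intro k hk
    have := h.mem (d * w - 1 - k) (by omega)
    rw [rv_in hk]; simp only; omega
  · intro r s hr hs
    obtain ⟨k, hk, e⟩ := h.surj (d - 1 - r) (w - 1 - s) (by omega) (by omega)
    refine ⟨d * w - 1 - k, by omega, ?_⟩
    rw [rv_in (by omega), show d * w - 1 - (d * w - 1 - k) = k by omega, e]
    simp only [Prod.mk.injEq]; omega
  · intro i j hi hj
    rw [rv_in hi, rv_in hj]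
    simp only
    intro e1 e2
    have m1 := h.mem (d * w - 1 - i) (by omega)
    have m2 := h.mem (d * w - 1 - j) (by omega)
    have := h.mono (d * w - 1 - j) (d * w - 1 - i) (by omega) (by omega) (by omega) (by omega)
    omega

theorem rv_sw (j : ℕ) (hj : j + 1 < d * w) :
    rv d w (sw j b) = sw (d * w - 2 - j) (rv d w b) := by
  funext k
  rw [sw_eq]
  by_cases hk : k < d * w
  · rw [rv_in hk, rv_in (by split_ifs <;> omega), sw_eq]
    have : (if d * w - 1 - k = j then j + 1 else if d * w - 1 - k = j + 1 then j
        else d * w - 1 - k) = d * w - 1 - (if k = d * w - 2 - j then d * w - 2 - j + 1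
          else if k = d * w - 2 - j + 1 then d * w - 2 - j else k) := by
      split_ifs <;> omega
    rw [this]
  · rw [if_neg (by omega), if_neg (by omega), DomRot.rv, DomRot.rv, if_neg hk, if_neg hk]

theorem Lin.ct_rv (h : Lin d w b) {k l : ℕ} (e : k + l + 1 = d * w) :
    ct (DomRot.rv d w b k) = (w : ℤ) - d - ct (b l) := by
  have := h.mem l (by omega)
  rw [rv_in (by omega), show d * w - 1 - k = l by omega]
  unfold ct; simp only; omega

theorem Lin.rv_dk (h : Lin d w b) (i : ℕ) (hi : i + 2 < d * w) :
    DomRot.rv d w (DomRot.dk i b) = DomRot.dk (d * w - 3 - i) (DomRot.rv d w b) := by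
  have c0 := h.ct_rv (k := d * w - 3 - i) (l := i + 2) (by omega)
  have c1 := h.ct_rv (k := d * w - 3 - i + 1) (l := i + 1) (by omega)
  have c2 := h.ct_rv (k := d * w - 3 - i + 2) (l := i) (by omega)
  have v1 := h.val.v1 i (by omega)
  have v2 := h.val.v1 (i + 1) (by omega)
  have v3 := h.val.v2 i (by omega)
  rw [dk.eq_def i, dk.eq_def (d * w - 3 - i), c0, c1, c2]
  split_ifs <;> first | (exfalso; omega) | rfl | skip
  all_goals rw [rv_sw _ (by omega)]; congr 1; omega

theorem Lin.rv_ds (h : Lin d w b) (i : ℕ) (hi : i + 1 < d * w) :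
    ds (d * w - 2 - i) (DomRot.rv d w b) ↔ ds i b := by
  have c0 := h.ct_rv (k := d * w - 2 - i) (l := i + 1) (by omega)
  have c1 := h.ct_rv (k := d * w - 2 - i + 1) (l := i) (by omega)
  unfold ds
  rw [c0, c1]; omega

/-- row reading word -/
def b0 (d w : ℕ) : Wd := fun k => if k < d * w then (k / w, k % w) else (0, 0)

theorem b0_in {k : ℕ} (hk : k < d * w) : b0 d w k = (k / w, k % w) := if_pos hk

theorem lin_b0 (d w : ℕ) : Lin d w (b0 d w) := by
  refine ⟨?_, ?_, ?_, ?_⟩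
  · intro k hk; exact if_neg (by omega)
  · intro k hk
    have hw : 0 < w := by rcases w with _ | w; simp at hk; omega
    rw [b0_in hk]
    exact ⟨Nat.div_lt_of_lt_mul (by rwa [mul_comm]), Nat.mod_lt _ hw⟩
  · intro r s hr hs
    have hk : r * w + s < d * w := by nlinarith
    refine ⟨r * w + s, hk, ?_⟩
    rw [b0_in hk]
    rw [mul_comm, Nat.mul_add_div (by omega), Nat.mul_add_mod, Nat.div_eq_of_lt hs,
      Nat.mod_eq_of_lt hs, add_zero]
  · intro i j hi hj
    rw [b0_in hi, b0_in hj]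
    simp only
    intro e1 e2
    rw [← Nat.div_add_mod i w, ← Nat.div_add_mod j w]
    have := Nat.mul_le_mul_left w e1
    omega

theorem pred_div (i : ℕ) (hw : 0 < w) (hc : (i + 1) % w ≠ 0) :
    i / w = (i + 1) / w ∧ i % w = (i + 1) % w - 1 := by
  have hlt : (i + 1) % w < w := Nat.mod_lt _ hw
  have e := Nat.div_add_mod (i + 1) w
  generalize (i + 1) / w = q at *
  generalize (i + 1) % w = r at *
  have e1 : i = w * q + (r - 1) := by omega
  subst e1
  rw [Nat.mul_add_div hw, Nat.mul_add_mod, Nat.div_eq_of_lt (by omega),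
    Nat.mod_eq_of_lt (by omega)]
  simp

theorem ds_b0 (i : ℕ) (hi : i + 1 < d * w) (h : ds i (b0 d w)) : (i + 1) % w = 0 := by
  by_contra hc
  have hw : 0 < w := by rcases w with _ | w; simp at hi; omega
  unfold ds at h
  rw [b0_in hi, b0_in (by omega)] at h
  have hlt : (i + 1) % w < w := Nat.mod_lt _ hw
  obtain ⟨q1, q2⟩ := pred_div i hw hc
  rw [q1, q2] at h
  unfold ct at h
  simp only at h
  omega

theorem uniq_b0 (h : Lin d w b) (hd : ∀ i, i + 1 < d * w → ds i b → (i + 1) % w = 0) :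
    b = b0 d w := by
  have key : ∀ k, k < d * w → b k = b0 d w k := by
    intro k
    induction k using Nat.strong_induction_on with
    | _ k ih =>
      intro hk
      have hw : 0 < w := by rcases w with _ | w; simp at hk; omega
      have m := h.mem k hk
      obtain ⟨l, hl, el⟩ := (lin_b0 d w).surj _ _ m.1 m.2
      have hkl : k ≤ l := by
        by_contra hc
        have := ih l (by omega) hl
        have := h.inj hl hk (by rw [this, el])
        omega
      rcases hkl.lt_or_eq with hlt | heq
      swap
      · subst heq; rw [el]
      exfalso
      -- the box to be filled at step k in b0 comes in b later
      have eb := b0_in hl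
      rw [el] at eb
      have e1 := congrArg Prod.fst eb
      have e2 := congrArg Prod.snd eb
      simp only at e1 e2
      -- box `b0 k` is `b u`
      have mk := (lin_b0 d w).mem k hk
      obtain ⟨u, hu, eu⟩ := h.surj _ _ mk.1 mk.2
      have hku : k < u := by
        rcases lt_trichotomy u k with q | q | q
        · have := ih u q hu
          rw [eu] at this
          have := (lin_b0 d w).inj hk hu this
          omega
        · subst q
          rw [eu] at el
          have := (lin_b0 d w).inj hl hk el
          omega
        · exact q
      have bk := b0_in hk
      rw [bk] at eu
      simp only at eu
      have hrow : k / w ≤ l / w := Nat.div_le_div_right (by omega)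
      have hnc : ¬ (k % w ≤ l % w) := by
        intro q
        have := h.mono u k hu hk (by rw [eu]; simp only; omega) (by rw [eu]; simp only; omega)
        omega
      -- k is not the start of a row; previous box of b
      have hmod : 0 < k % w := by omega
      obtain ⟨k', rfl⟩ : ∃ k', k = k' + 1 := ⟨k - 1, by
        rcases k with _ | k
        · simp at hmod
        · rfl⟩
      have hdd := mt (hd k' hk) (by omega)
      apply hdd
      have hk' := ih k' (by omega) (by omega)
      unfold ds
      rw [hk', b0_in (by omega)]
      obtain ⟨q1, q2⟩ := pred_div k' hw hmod.ne'
      have hrow2 : (k' + 1) / w < l / w := by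
        by_contra hc
        have r1 := Nat.div_add_mod l w
        have : l / w = (k' + 1) / w := by omega
        have r2 := Nat.div_add_mod (k' + 1) w
        rw [this] at r1
        omega
      unfold ct
      simp only [q1, q2]
      omega
  funext k
  by_cases hk : k < d * w
  · exact key k hk
  · rw [h.out k (by omega), (lin_b0 d w).out k (by omega)]

theorem rv_b0 (d w : ℕ) : rv d w (b0 d w) = b0 d w := by
  refine uniq_b0 (lin_b0 d w).rv ?_
  intro i hi h
  have := (lin_b0 d w).rv_ds (d * w - 2 - i) (by omega)
  rw [show d * w - 2 - (d * w - 2 - i) = i by omega] at this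
  have := ds_b0 _ (by omega) (this.1 h)
  have e : (i + 1) + (d * w - 2 - i + 1) = d * w := by omega
  have h1 : w ∣ d * w - 2 - i + 1 := Nat.dvd_of_mod_eq_zero this
  have h2 : w ∣ (i + 1) + (d * w - 2 - i + 1) := by rw [e]; exact Dvd.intro_left d rfl
  exact Nat.mod_eq_zero_of_dvd ((Nat.dvd_add_left h1).1 h2)

theorem ev_b0 (hN : 0 < d * w) : ev tP (d * w - 1) (b0 d w) = b0 d w := by
  refine uniq_b0 ((lin_b0 d w).ev (by omega)) ?_
  intro i hi h
  have := ev_ds (d := d) (w := w) (d * w - 1) (d * w - 2 - i) (by omega) (by omega) _ (lin_b0 d w)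
  rw [show d * w - 1 - 1 - (d * w - 2 - i) = i by omega] at this
  have := ds_b0 _ (by omega) (this.1 h)
  have e : (i + 1) + (d * w - 2 - i + 1) = d * w := by omega
  have h1 : w ∣ d * w - 2 - i + 1 := Nat.dvd_of_mod_eq_zero this
  have h2 : w ∣ (i + 1) + (d * w - 2 - i + 1) := by rw [e]; exact Dvd.intro_left d rfl
  exact Nat.mod_eq_zero_of_dvd ((Nat.dvd_add_left h1).1 h2)

end DomRot

namespace DomRot

variable {d w : ℕ} {b : Wd}

theorem Lin.move (m : ℕ) (hm : m ≤ d * w) (p : ℕ × ℕ) (t : ℕ) : ∀ k b, k + 1 + t = m →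
    Lin d w b → b k = p →
    (∀ j, j < m → p.1 ≤ (b j).1 → p.2 ≤ (b j).2 → b j = p) →
    ∃ b', Lin d w b' ∧ (∀ j, m ≤ j → b' j = b j) ∧ b' (m - 1) = p := by
  induction t with
  | zero =>
    intro k b hk h e _
    exact ⟨b, h, fun _ _ => rfl, by rw [← e]; congr 1; omega⟩
  | succ t ih =>
    intro k b hk h e hmax
    have h' : Lin d w (DomRot.sw k b) := by
      refine h.sw (by omega) ?_
      rintro ⟨q1, q2⟩
      have := hmax (k + 1) (by omega) (by rw [← e]; exact q1) (by rw [← e]; exact q2)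
      have := h.inj (i := k) (j := k + 1) (by omega) (by omega) (by rw [this, e])
      omega
    obtain ⟨b', g1, g2, g3⟩ := ih (k + 1) (DomRot.sw k b) (by omega) h' (by rw [sw_r, e]) (by
      intro j hj
      rw [sw_eq]
      exact hmax _ (by split_ifs <;> omega))
    refine ⟨b', g1, ?_, g3⟩
    intro j hj
    rw [g2 j hj, sw_o _ _ _ (by omega) (by omega)]

theorem agree_mem {b b' : Wd} (h : Lin d w b) (h' : Lin d w b') {m : ℕ}
    (e : ∀ j, m ≤ j → b j = b' j) {j : ℕ} (hj : j < m) (hm : j < d * w) :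
    ∃ u, u < m ∧ u < d * w ∧ b' u = b j := by
  obtain ⟨u, hu, eu⟩ := h'.surj _ _ (h.mem j hm).1 (h.mem j hm).2
  refine ⟨u, ?_, hu, eu⟩
  by_contra hc
  have e1 := e u (by omega)
  have := h.inj hu hm (by rw [e1, eu])
  omega

theorem Lin.down (h : Lin d w b) {j : ℕ} (hj : j < d * w) {r s : ℕ} (h1 : r ≤ (b j).1)
    (h2 : s ≤ (b j).2) : ∃ u, u ≤ j ∧ b u = (r, s) := by
  have := h.mem j hj
  obtain ⟨u, hu, eu⟩ := h.surj r s (by omega) (by omega)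
  exact ⟨u, h.mono u j hu hj (by rw [eu]; exact h1) (by rw [eu]; exact h2), eu⟩

theorem exists_mid (h : Lin d w b) {m : ℕ} (hm : m < d * w) {A B : ℕ × ℕ} {x y : ℕ}
    (hx : x ≤ m) (hy : y ≤ m) (eA : b x = A) (eB : b y = B)
    (mA : ∀ j, j ≤ m → A.1 ≤ (b j).1 → A.2 ≤ (b j).2 → b j = A)
    (mB : ∀ j, j ≤ m → B.1 ≤ (b j).1 → B.2 ≤ (b j).2 → b j = B)
    (hlt : ct A < ct B) :
    ∃ z, z ≤ m ∧ ct A < ct (b z) ∧ ct (b z) < ct B ∧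
      ∀ j, j ≤ m → (b z).1 ≤ (b j).1 → (b z).2 ≤ (b j).2 → b j = b z ∨ b j = A ∨ b j = B := by
  have hne : A ≠ B := by rintro rfl; omega
  have i1 : ¬ (A.1 ≤ B.1 ∧ A.2 ≤ B.2) := by
    rintro ⟨q1, q2⟩
    have := mA y hy (by rw [eB]; exact q1) (by rw [eB]; exact q2)
    exact hne (by rw [← this, eB])
  have i2 : ¬ (B.1 ≤ A.1 ∧ B.2 ≤ A.2) := by
    rintro ⟨q1, q2⟩
    have := mB x hx (by rw [eA]; exact q1) (by rw [eA]; exact q2)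
    exact hne (by rw [← this, eA])
  have i3 : B.1 < A.1 ∧ A.2 < B.2 := by unfold ct at hlt; omega
  let S := (Finset.range (m + 1)).filter (fun z => ct A < ct (b z) ∧ ct (b z) < ct B)
  have hS : S.Nonempty := by
    obtain ⟨u, hu, eu⟩ := h.down (j := y) (by omega) (r := B.1) (s := B.2 - 1)
      (by rw [eB]) (by rw [eB]; omega)
    refine ⟨u, ?_⟩
    simp only [S, Finset.mem_filter, Finset.mem_range]
    rw [eu]
    unfold ct
    simp only
    omega
  obtain ⟨z, hz, zmax⟩ := Finset.exists_max_image S (fun z => (b z).1 + (b z).2) hS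
  simp only [S, Finset.mem_filter, Finset.mem_range] at hz zmax
  refine ⟨z, by omega, hz.2.1, hz.2.2, ?_⟩
  -- no in-range box strictly above with content in between
  have no : ∀ r s, ∀ j, j ≤ m → r ≤ (b j).1 → s ≤ (b j).2 → (b z).1 + (b z).2 < r + s →
      ct A < ct (r, s) → ct (r, s) < ct B → False := by
    intro r s j hj h1 h2 h3 h4 h5
    obtain ⟨u, hu, eu⟩ := h.down (by omega) h1 h2
    have := zmax u ⟨by omega, by rw [eu]; exact h4, by rw [eu]; exact h5⟩
    rw [eu] at this
    simp only at this
    omega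
  intro j hj h1 h2
  by_contra hc
  push Not at hc
  obtain ⟨c1, c2, c3⟩ := hc
  have hs : (b z).1 + (b z).2 < (b j).1 + (b j).2 := by
    by_contra q
    exact c1 (Prod.ext (by omega) (by omega))
  have cz1 := hz.2.1
  have cz2 := hz.2.2
  by_cases q1 : ct B ≤ ct (b j)
  · have hc1 : (b z).2 + 1 ≤ (b j).2 := by unfold ct at *; omega
    have n1 := no (b z).1 ((b z).2 + 1) j hj h1 hc1 (by omega)
    have n2 := no ((b z).1 + 1) ((b z).2 + 1) y hy
    rw [eB] at n2
    have cc : ct ((b z).1, (b z).2 + 1) = ct (b z) + 1 := by unfold ct; simp only; omega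
    have cc2 : ct ((b z).1 + 1, (b z).2 + 1) = ct (b z) := by unfold ct; simp only; omega
    rw [cc] at n1
    rw [cc2] at n2
    have hB : ct (b z) + 1 = ct B := by
      by_contra q
      exact n1 (by omega) (by omega)
    by_cases q2 : B.1 ≤ (b z).1
    · exact c3 (mB j hj (by omega) (by unfold ct at hB; omega))
    · exact n2 (by omega) (by unfold ct at hB; omega) (by omega) (by omega) (by omega)
  · by_cases q2 : ct (b j) ≤ ct A
    · have hc1 : (b z).1 + 1 ≤ (b j).1 := by unfold ct at *; omega
      have n1 := no ((b z).1 + 1) (b z).2 j hj hc1 h2 (by omega)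
      have n2 := no ((b z).1 + 1) ((b z).2 + 1) x hx
      rw [eA] at n2
      have cc : ct ((b z).1 + 1, (b z).2) = ct (b z) - 1 := by unfold ct; simp only; omega
      have cc2 : ct ((b z).1 + 1, (b z).2 + 1) = ct (b z) := by unfold ct; simp only; omega
      rw [cc] at n1
      rw [cc2] at n2
      have hA : ct (b z) - 1 = ct A := by
        by_contra q
        exact n1 (by omega) (by omega)
      by_cases q2 : A.2 ≤ (b z).2
      · exact c2 (mA j hj (by unfold ct at hA; omega) (by omega))
      · exact n2 (by unfold ct at hA; omega) (by omega) (by omega) (by omega) (by omega)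
    · exact no (b j).1 (b j).2 j hj le_rfl le_rfl hs (by simpa using not_le.1 q2)
        (by simpa using not_le.1 q1)

theorem conn (Q : Wd → Prop)
    (hQ : ∀ b i, Lin d w b → i + 2 < d * w → (Q b ↔ Q (dk i b))) (m : ℕ) :
    m ≤ d * w → ∀ b b', Lin d w b → Lin d w b' → (∀ j, m ≤ j → b j = b' j) → (Q b ↔ Q b') := by
  induction m with
  | zero =>
    intro _ b b' _ _ e
    have : b = b' := funext fun j => e j (by omega)
    rw [this]
  | succ m ih =>
    intro hm
    have main : ∀ b b', Lin d w b → Lin d w b' → (∀ j, m + 1 ≤ j → b j = b' j) →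
        ct (b m) < ct (b' m) → (Q b ↔ Q b') := by
      intro b b' h h' e hlt
      have mA : ∀ j, j ≤ m → (b m).1 ≤ (b j).1 → (b m).2 ≤ (b j).2 → b j = b m := by
        intro j hj h1 h2
        have := h.mono m j (by omega) (by omega) h1 h2
        congr 1; omega
      have mB : ∀ j, j ≤ m → (b' m).1 ≤ (b j).1 → (b' m).2 ≤ (b j).2 → b j = b' m := by
        intro j hj h1 h2
        obtain ⟨u, hu, hu2, eu⟩ := agree_mem h h' e (j := j) (by omega) (by omega)
        rw [← eu] at h1 h2 ⊢
        have := h'.mono m u (by omega) (by omega) h1 h2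
        congr 1; omega
      obtain ⟨y, hy, hy2, ey⟩ := agree_mem h' h (fun j hj => (e j hj).symm) (j := m)
        (by omega) (by omega)
      obtain ⟨z, hz, z1, z2, z3⟩ := exists_mid h (by omega) (A := b m) (B := b' m) le_rfl
        (by omega) rfl ey mA mB hlt
      have hym : y ≠ m := by rintro rfl; rw [ey] at hlt; omega
      have hzm : z ≠ m := by rintro rfl; omega
      have hzy : z ≠ y := by rintro rfl; rw [ey] at z2; omega
      obtain ⟨b1, l1, a1, p1⟩ := Lin.move (d := d) (w := w) m (by omega) (b' m) (m - 1 - y) y b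
        (by omega) h ey (fun j hj => mB j (by omega))
      obtain ⟨k, hk, hk2, ek⟩ := agree_mem h l1 (fun j hj => (a1 j hj).symm) (j := z)
        (by omega) (by omega)
      have hkm : k ≠ m - 1 := by
        rintro rfl
        rw [p1] at ek; rw [← ek] at z2; omega
      obtain ⟨b2, l2, a2, p2⟩ := Lin.move (d := d) (w := w) (m - 1) (by omega) (b z) (m - 2 - k) k
        b1 (by omega) l1 ek (by
          intro j hj h1 h2
          obtain ⟨u, hu, hu2, eu⟩ := agree_mem l1 h a1 (j := j) (by omega) (by omega)
          rw [← eu] at h1 h2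
          rcases z3 u (by omega) h1 h2 with q | q | q
          · rw [← eu, q]
          · have := h.inj hu2 (by omega) q
            omega
          · rw [eu, ← p1] at q
            have := l1.inj (by omega) (by omega) q
            omega)
      have hm2 : 2 ≤ m := by omega
      obtain ⟨n, rfl⟩ : ∃ n, m = n + 2 := ⟨m - 2, by omega⟩
      have f0 : b2 n = b z := p2
      have f1 : b2 (n + 1) = b' (n + 2) := by rw [a2 (n + 1) (by omega)]; exact p1
      have f2 : b2 (n + 2) = b (n + 2) := by rw [a2 _ (by omega), a1 _ (by omega)]
      have hdk : dk n b2 = sw (n + 1) b2 := by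
        rw [dk, if_pos]
        rw [f0, f1, f2]; omega
      have s1 : Q b ↔ Q b2 := ih (by omega) b b2 h l2 (by
        intro j hj; rw [a2 _ (by omega), a1 _ (by omega)])
      have s3 : Q (dk n b2) ↔ Q b' := ih (by omega) _ b' (l2.dk (by omega)) h' (by
        intro j hj
        rw [hdk]
        by_cases q : j = n + 2
        · rw [q, sw_r, f1]
        · rw [sw_o _ _ _ (by omega) (by omega), a2 _ (by omega), a1 _ (by omega), e j (by omega)])
      rw [s1, hQ b2 n l2 (by omega), s3]
    intro b b' h h' e
    by_cases q : b m = b' m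
    · refine ih (by omega) b b' h h' ?_
      intro j hj
      by_cases q' : j = m
      · rw [q', q]
      · exact e j (by omega)
    · rcases lt_trichotomy (ct (b m)) (ct (b' m)) with c | c | c
      · exact main b b' h h' e c
      · exfalso
        obtain ⟨y, hy, hy2, ey⟩ := agree_mem h' h (fun j hj => (e j hj).symm) (j := m)
          (by omega) (by omega)
        obtain ⟨x, hx, hx2, ex⟩ := agree_mem h h' e (j := m) (by omega) (by omega)
        have : ((b m).1 ≤ (b' m).1 ∧ (b m).2 ≤ (b' m).2) ∨
            ((b' m).1 ≤ (b m).1 ∧ (b' m).2 ≤ (b m).2) := by unfold ct at c; omega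
        rcases this with ⟨q1, q2⟩ | ⟨q1, q2⟩
        · have := h.mono m y (by omega) hy2 (by rw [ey]; exact q1) (by rw [ey]; exact q2)
          have : y = m := by omega
          rw [this] at ey
          exact q ey
        · have := h'.mono m x (by omega) hx2 (by rw [ex]; exact q1) (by rw [ex]; exact q2)
          have : x = m := by omega
          rw [this] at ex
          exact q ex.symm
      · exact (main b' b h' h (fun j hj => (e j hj).symm) c).symm

theorem Lin.ev_eq_rv (h : Lin d w b) (hN : 0 < d * w) :
    DomRot.ev tP (d * w - 1) b = DomRot.rv d w b := by
  have := conn (d := d) (w := w) (fun b => DomRot.ev tP (d * w - 1) b = DomRot.rv d w b) (by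
    intro b i h hi
    show _ ↔ _
    rw [ev_dk (d := d) (w := w) _ i (by omega) (by omega) b h, h.rv_dk i hi,
      show d * w - 1 - 2 - i = d * w - 3 - i by omega]
    constructor
    · intro e; rw [e]
    · intro e
      have := congrArg (DomRot.dk (d * w - 3 - i)) e
      rwa [dk_dk, dk_dk] at this) (d * w) le_rfl b (b0 d w) h (lin_b0 d w) (by
    intro j hj
    rw [h.out j hj, (lin_b0 d w).out j hj])
  rw [this, ev_b0 hN, rv_b0]

end DomRot

namespace DomRot

variable {d w : ℕ} {b : Wd}

theorem dm_hi (m : ℕ) (b : Wd) (k : ℕ) (hk : 2 * m + 1 < k) : dm tP m b k = b k := by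
  induction m with
  | zero => rw [dm, tP_apply, tg_o _ _ _ (by omega) (by omega)]
  | succ m ih =>
    rw [dm, Equiv.Perm.mul_apply, tP_apply, tg_o _ _ _ (by omega) (by omega), ih (by omega)]

theorem dm_fix (m : ℕ) (b : Wd) : dm tP m b = b ↔ ∀ k, k ≤ m → tg (2 * k) b = b := by
  induction m with
  | zero =>
    rw [dm, tP_apply]
    constructor
    · intro e k hk
      obtain rfl : k = 0 := by omega
      exact e
    · intro e; exact e 0 le_rfl
  | succ m ih =>
    constructor
    · intro e
      have e1 : dm tP m b = b := by
        funext k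
        by_cases hk : 2 * m + 1 < k
        · exact dm_hi m b k hk
        · conv_rhs => rw [← e]
          rw [dm, Equiv.Perm.mul_apply, tP_apply, tg_o _ _ _ (by omega) (by omega)]
      rw [dm, Equiv.Perm.mul_apply, tP_apply, e1] at e
      intro k hk
      by_cases q : k = m + 1
      · rw [q]; exact e
      · exact ih.1 e1 k (by omega)
    · intro e
      rw [dm, Equiv.Perm.mul_apply, tP_apply, ih.2 (fun k hk => e k (by omega))]
      exact e (m + 1) le_rfl

theorem tg_fix (i : ℕ) (b : Wd) : tg i b = b ↔
    ct (b (i + 1)) < ct (b i) + 2 ∧ ct (b i) < ct (b (i + 1)) + 2 := by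
  unfold tg
  split_ifs with h
  · constructor
    · intro e
      have := congrFun e i
      rw [sw_l] at this
      rw [this] at h
      omega
    · intro q; omega
  · constructor
    · intro _; omega
    · intro _; rfl

theorem card_eq (m : ℕ) (hm : d * w = 2 * m + 2) :
    {b | Lin d w b ∧ rv d w b = b}.ncard =
    {b | Lin d w b ∧ ∀ k, k ≤ m → ct (b (2 * k + 1)) < ct (b (2 * k)) + 2 ∧
      ct (b (2 * k)) < ct (b (2 * k + 1)) + 2}.ncard := by
  obtain ⟨g, hg, e⟩ := ev_dm tP tP_sq tP_comm m
  have gl : ∀ b, Lin d w (g b) ↔ Lin d w b := by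
    refine Subgroup.closure_induction (p := fun x _ => ∀ b, Lin d w (x b) ↔ Lin d w b)
        ?_ ?_ ?_ ?_ hg
    · rintro x ⟨i, hi, rfl⟩ b
      rw [tP_apply]
      constructor
      · intro q
        have := q.tg (i := i) (by omega)
        rwa [tg_tg] at this
      · intro q; exact q.tg (by omega)
    · intro b; rfl
    · intro x y _ _ hx hy b
      rw [Equiv.Perm.mul_apply, hx, hy]
    · intro x _ hx b
      rw [← hx (x⁻¹ b), ← Equiv.Perm.mul_apply, mul_inv_cancel, Equiv.Perm.one_apply]
  rw [← Set.ncard_image_of_injective _ g.injective]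
  congr 1
  ext c
  simp only [Set.mem_image, Set.mem_ofPred_eq]
  have key : ∀ b, Lin d w b → (rv d w b = b ↔ dm tP m (g b) = g b) := by
    intro b h
    rw [← h.ev_eq_rv (by omega), show d * w - 1 = 2 * m + 1 by omega, e, Equiv.Perm.mul_apply,
      Equiv.Perm.mul_apply, Equiv.Perm.inv_eq_iff_eq]
  have key2 : ∀ c, dm tP m c = c ↔ ∀ k, k ≤ m → ct (c (2 * k + 1)) < ct (c (2 * k)) + 2 ∧
      ct (c (2 * k)) < ct (c (2 * k + 1)) + 2 := by
    intro c
    rw [dm_fix]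
    simp only [tg_fix]
  constructor
  · rintro ⟨b, ⟨h1, h2⟩, rfl⟩
    exact ⟨(gl b).2 h1, (key2 _).1 ((key b h1).1 h2)⟩
  · rintro ⟨h1, h2⟩
    have hc : g (g⁻¹ c) = c := by
      rw [← Equiv.Perm.mul_apply, mul_inv_cancel, Equiv.Perm.one_apply]
    have h3 : Lin d w (g⁻¹ c) := by rw [← gl, hc]; exact h1
    refine ⟨g⁻¹ c, ⟨h3, ?_⟩, hc⟩
    rw [key _ h3, hc, key2]
    exact h2

end DomRot

namespace DomRot

variable {d w : ℕ} {b : Wd}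

/-- tableau of a word -/
def tab (d w : ℕ) (b : Wd) (i j : ℕ) : ℕ :=
  ∑ k ∈ Finset.range (d * w), if b k = (i, j) then k + 1 else 0

theorem Lin.tab_at (h : Lin d w b) {k i j : ℕ} (hk : k < d * w) (e : b k = (i, j)) :
    tab d w b i j = k + 1 := by
  unfold tab
  rw [Finset.sum_eq_single k]
  · rw [if_pos e]
  · intro l hl hne
    rw [if_neg]
    intro q
    exact hne (h.inj (Finset.mem_range.1 hl) hk (by rw [q, e]))
  · intro q; exact absurd (Finset.mem_range.2 hk) q

theorem Lin.tab_out (h : Lin d w b) {i j : ℕ} (hc : ¬ (i < d ∧ j < w)) : tab d w b i j = 0 := by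
  unfold tab
  refine Finset.sum_eq_zero ?_
  intro k hk
  rw [if_neg]
  intro e
  have := h.mem k (Finset.mem_range.1 hk)
  rw [e] at this
  exact hc this

theorem inShape_iff (i j : ℕ) : InShape (rectPart d w) (zeroPart d w) i j ↔ i < d ∧ j < w := by
  unfold InShape rectPart zeroPart
  simp only
  constructor
  · rintro ⟨h1, -, h3⟩; rw [if_pos h1] at h3; exact ⟨h1, h3⟩
  · rintro ⟨h1, h3⟩; rw [if_pos h1]; exact ⟨h1, Nat.zero_le _, h3⟩

theorem tab_inj : Set.InjOn (tab d w) {b | Lin d w b} := by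
  intro b hb b' hb' e
  have h : Lin d w b := hb
  have h' : Lin d w b' := hb'
  funext k
  by_cases hk : k < d * w
  · obtain ⟨l, hl, el⟩ := h'.surj _ _ (h.mem k hk).1 (h.mem k hk).2
    have e1 := h.tab_at hk rfl
    have e2 := h'.tab_at hl el
    rw [← e, e1] at e2
    have : k = l := by omega
    rw [this, el, ← this]
  · rw [h.out k (by omega), h'.out k (by omega)]

theorem syt_mono {E : ℕ → ℕ → ℕ} (hE : IsSYT d w E) {r s r' s' : ℕ} (h1 : r ≤ r') (h2 : s ≤ s')
    (h3 : r' < d) (h4 : s' < w) : E r s ≤ E r' s' := by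
  obtain ⟨-, -, e1, e2, -⟩ := hE
  have a : E r s ≤ E r' s := by
    induction r', h1 using Nat.le_induction with
    | base => exact le_rfl
    | succ n hn ih => exact (ih (by omega)).trans (e2 n s h3 (by omega)).le
  refine a.trans ?_
  induction s', h2 using Nat.le_induction with
  | base => exact le_rfl
  | succ n hn ih => exact (ih (by omega)).trans (e1 r' n h3 h4).le

theorem syt_inj {E : ℕ → ℕ → ℕ} (hE : IsSYT d w E) {r s r' s' : ℕ} (h1 : r < d) (h2 : s < w)
    (h3 : r' < d) (h4 : s' < w) (e : E r s = E r' s') : (r, s) = (r', s') := by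
  have := Finset.injOn_of_surjOn_of_card_le (s := Finset.range d ×ˢ Finset.range w)
    (t := Finset.Icc 1 (d * w)) (fun p : ℕ × ℕ => E p.1 p.2)
    (by
      rintro ⟨i, j⟩ hp
      simp only [Finset.coe_product, Finset.coe_range, Set.mem_prod, Set.mem_Iio] at hp
      simp only [Finset.coe_Icc, Set.mem_Icc]
      exact hE.2.1 i j hp.1 hp.2)
    (by
      intro m hm
      simp only [Finset.coe_Icc, Set.mem_Icc] at hm
      obtain ⟨i, j, q1, q2, q3⟩ := hE.2.2.2.2 m hm.1 hm.2
      exact ⟨(i, j), by simp [q1, q2], q3⟩)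
    (by simp)
  exact this (by simp [h1, h2]) (by simp [h3, h4]) e

theorem syt_card : {E : ℕ → ℕ → ℕ | IsSYT d w E ∧
    RotInvariant (d * w) (rectPart d w) (zeroPart d w) E}.ncard =
    {b | Lin d w b ∧ rv d w b = b}.ncard := by
  rw [← Set.ncard_image_of_injOn (f := tab d w) (s := {b | Lin d w b ∧ rv d w b = b})
    (tab_inj.mono fun b hb => hb.1)]
  congr 1
  ext E
  simp only [Set.mem_image, Set.mem_ofPred_eq]
  constructor
  · rintro ⟨hE, hR⟩
    have hch : ∀ k, ∃ p : ℕ × ℕ, (k < d * w → p.1 < d ∧ p.2 < w ∧ E p.1 p.2 = k + 1) ∧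
        (d * w ≤ k → p = (0, 0)) := by
      intro k
      by_cases hk : k < d * w
      · obtain ⟨i, j, q⟩ := hE.2.2.2.2 (k + 1) (by omega) (by omega)
        exact ⟨(i, j), fun _ => q, fun _ => by omega⟩
      · exact ⟨(0, 0), fun _ => by omega, fun _ => rfl⟩
    choose b hb1 hb2 using hch
    have hl : Lin d w b := by
      refine ⟨hb2, fun k hk => ⟨(hb1 k hk).1, (hb1 k hk).2.1⟩, ?_, ?_⟩
      · intro r s hr hs
        have := hE.2.1 r s hr hs
        obtain ⟨q1, q2, q3⟩ := hb1 (E r s - 1) (by omega)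
        exact ⟨E r s - 1, by omega, syt_inj hE q1 q2 hr hs (by omega)⟩
      · intro i j hi hj h1 h2
        obtain ⟨q1, q2, q3⟩ := hb1 i hi
        obtain ⟨p1, p2, p3⟩ := hb1 j hj
        have := syt_mono hE h1 h2 p1 p2
        omega
    refine ⟨b, ⟨hl, ?_⟩, ?_⟩
    · funext k
      by_cases hk : k < d * w
      · rw [rv_in hk]
        obtain ⟨q1, q2, q3⟩ := hb1 k hk
        obtain ⟨p1, p2, p3⟩ := hb1 (d * w - 1 - k) (by omega)
        have := (hR _ _ ((inShape_iff _ _).2 ⟨p1, p2⟩)).2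
        exact syt_inj hE (by omega) (by omega) q1 q2 (by omega)
      · rw [hl.out k (by omega), hl.rv.out k (by omega)]
    · funext r s
      by_cases hc : r < d ∧ s < w
      · obtain ⟨k, hk, ek⟩ := hl.surj r s hc.1 hc.2
        have := (hb1 k hk).2.2
        rw [ek] at this
        rw [hl.tab_at hk ek, this]
      · rw [hl.tab_out hc, hE.1 r s (by omega)]
  · rintro ⟨b, ⟨h, hr⟩, rfl⟩
    have lt : ∀ i j i' j', i' < d → j' < w → i ≤ i' → j ≤ j' → (i, j) ≠ (i', j') →
        tab d w b i j < tab d w b i' j' := by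
      intro i j i' j' h1 h2 h3 h4 hne
      obtain ⟨k, hk, ek⟩ := h.surj i j (by omega) (by omega)
      obtain ⟨l, hl, el⟩ := h.surj i' j' h1 h2
      rw [h.tab_at hk ek, h.tab_at hl el]
      have := h.mono k l hk hl (by rw [ek, el]; exact h3) (by rw [ek, el]; exact h4)
      have : k ≠ l := by rintro rfl; exact hne (ek.symm.trans el)
      omega
    refine ⟨⟨?_, ?_, ?_, ?_, ?_⟩, ?_⟩
    · intro i j hij; exact h.tab_out (by omega)
    · intro i j hi hj
      obtain ⟨k, hk, ek⟩ := h.surj i j hi hj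
      rw [h.tab_at hk ek]; omega
    · intro i j hi hj
      exact lt _ _ _ _ hi hj le_rfl (by omega) (by simp)
    · intro i j hi hj
      exact lt _ _ _ _ hi hj (by omega) le_rfl (by simp)
    · intro m h1 h2
      have := h.mem (m - 1) (by omega)
      exact ⟨_, _, this.1, this.2, by rw [h.tab_at (k := m - 1) (by omega) rfl]; omega⟩
    · intro i j hij
      rw [inShape_iff] at hij
      obtain ⟨k, hk, ek⟩ := h.surj i j hij.1 hij.2
      refine ⟨(inShape_iff _ _).2 (by omega), ?_⟩
      have e : b (d * w - 1 - k) = (d - 1 - i, w - 1 - j) := by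
        conv_lhs => rw [← hr]
        rw [rv_in (by omega), show d * w - 1 - (d * w - 1 - k) = k by omega, ek]
      rw [h.tab_at hk ek, h.tab_at (by omega) e]
      omega

theorem ribbon_pair {p q : ℕ × ℕ} (h : BoxAdj p q) : IsRibbon 2 {p, q} := by
  have hne : p ≠ q := by rintro rfl; unfold BoxAdj at h; omega
  have hs : BoxAdj q p := by unfold BoxAdj at *; omega
  refine ⟨Set.ncard_pair hne, ?_, ?_⟩
  · intro u hu v hv
    have m1 : p ∈ ({p, q} : Set (ℕ × ℕ)) := by simp
    have m2 : q ∈ ({p, q} : Set (ℕ × ℕ)) := by simp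
    rcases hu with rfl | rfl <;> rcases hv with rfl | rfl
    · exact Relation.ReflTransGen.refl
    · exact Relation.ReflTransGen.single ⟨m1, m2, h⟩
    · exact Relation.ReflTransGen.single ⟨m2, m1, hs⟩
    · exact Relation.ReflTransGen.refl
  · rintro ⟨i, j, h1, h2, h3, -⟩
    rcases h1 with rfl | rfl <;> rcases h2 with e2 | e2 <;> rcases h3 with e3 | e3 <;>
      simp_all [Prod.ext_iff]

theorem ribbon_two {S : Set (ℕ × ℕ)} (h : IsRibbon 2 S) : ∃ p q, S = {p, q} ∧
    (q = (p.1 + 1, p.2) ∨ q = (p.1, p.2 + 1)) := by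
  obtain ⟨h1, h2, -⟩ := h
  obtain ⟨p, q, hne, rfl⟩ := Set.ncard_eq_two.1 h1
  have h3 := h2 p (by simp) q (by simp)
  have hadj : BoxAdj p q := by
    rcases Relation.ReflTransGen.cases_head h3 with e | ⟨c, ⟨-, hc, ha⟩, -⟩
    · exact absurd e hne
    · rcases hc with e | e
      · subst e; unfold BoxAdj at ha; omega
      · rw [Set.mem_singleton_iff] at e; rwa [e] at ha
  by_cases hd : p.1 ≤ q.1 ∧ p.2 ≤ q.2
  · refine ⟨p, q, rfl, ?_⟩
    simp only [Prod.ext_iff]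
    unfold BoxAdj at hadj; omega
  · refine ⟨q, p, Set.pair_comm _ _, ?_⟩
    simp only [Prod.ext_iff]
    unfold BoxAdj at hadj; omega

theorem Lin.close (h : Lin d w b) {i : ℕ} (hi : i + 1 < d * w)
    (hc : ct (b (i + 1)) < ct (b i) + 2 ∧ ct (b i) < ct (b (i + 1)) + 2) :
    ((b (i + 1)).1 = (b i).1 + 1 ∧ (b (i + 1)).2 = (b i).2) ∨
    ((b (i + 1)).1 = (b i).1 ∧ (b (i + 1)).2 = (b i).2 + 1) := by
  have v := h.val.v1 i hi
  have hn : ¬ ((b (i + 1)).1 ≤ (b i).1 ∧ (b (i + 1)).2 ≤ (b i).2) := by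
    rintro ⟨q1, q2⟩
    have := h.mono _ _ hi (by omega) q1 q2
    omega
  have : (b i).1 ≤ (b (i + 1)).1 ∧ (b i).2 ≤ (b (i + 1)).2 := by
    unfold ct at *; omega
  exact h.adj hi this.1 this.2

/-- words of domino type -/
def Dom (d w m : ℕ) (b : Wd) : Prop := Lin d w b ∧ ∀ k, k ≤ m →
  ct (b (2 * k + 1)) < ct (b (2 * k)) + 2 ∧ ct (b (2 * k)) < ct (b (2 * k + 1)) + 2

/-- domino tableau of a word -/
def dtab (d w : ℕ) (b : Wd) (i j : ℕ) : ℕ := (tab d w b i j + 1) / 2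

theorem dtab_inj (m : ℕ) (hm : d * w = 2 * m + 2) : Set.InjOn (dtab d w) {b | Dom d w m b} := by
  rintro b ⟨h, hc⟩ b' ⟨h', hc'⟩ e
  have loc : ∀ k, k < d * w → ∃ l, l < d * w ∧ l / 2 = k / 2 ∧ b' l = b k := by
    intro k hk
    obtain ⟨l, hl, el⟩ := h'.surj _ _ (h.mem k hk).1 (h.mem k hk).2
    have e1 := congrFun (congrFun e (b k).1) (b k).2
    unfold dtab at e1
    rw [h.tab_at hk rfl, h'.tab_at hl el] at e1
    exact ⟨l, hl, by omega, el⟩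
  have key : ∀ q, q ≤ m → b (2 * q) = b' (2 * q) ∧ b (2 * q + 1) = b' (2 * q + 1) := by
    intro q hq
    obtain ⟨l, hl, el, e1⟩ := loc (2 * q) (by omega)
    obtain ⟨l', hl', el', e1'⟩ := loc (2 * q + 1) (by omega)
    have hne : l ≠ l' := by
      rintro rfl
      have := h.inj (i := 2 * q) (j := 2 * q + 1) (by omega) (by omega) (by rw [← e1, e1'])
      omega
    have cl := h.close (i := 2 * q) (by omega) (hc q hq)
    by_cases q1 : l = 2 * q
    · have q2 : l' = 2 * q + 1 := by omega
      subst q1 q2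
      exact ⟨e1.symm, e1'.symm⟩
    · exfalso
      have := h'.mono l l' hl hl' (by rw [e1, e1']; omega) (by rw [e1, e1']; omega)
      omega
  funext k
  by_cases hk : k < d * w
  · have := key (k / 2) (by omega)
    rcases Nat.even_or_odd' k with ⟨q, rfl | rfl⟩
    · rw [show 2 * q / 2 = q by omega] at this; exact this.1
    · rw [show (2 * q + 1) / 2 = q by omega] at this; exact this.2
  · rw [h.out k (by omega), h'.out k (by omega)]

theorem srt_mono {E : ℕ → ℕ → ℕ} {ℓ : ℕ} (hE : IsSRT 2 ℓ (rectPart d w) (zeroPart d w) E)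
    {r s r' s' : ℕ} (h1 : r ≤ r') (h2 : s ≤ s') (h3 : r' < d) (h4 : s' < w) :
    E r s ≤ E r' s' :=
  (hE.2.2.1 r s s' ((inShape_iff _ _).2 (by omega)) ((inShape_iff _ _).2 (by omega)) h2).trans
    (hE.2.2.2.1 r r' s' ((inShape_iff _ _).2 (by omega)) ((inShape_iff _ _).2 (by omega)) h1)

theorem srt_card (m : ℕ) (hm : d * w = 2 * m + 2) :
    {E : ℕ → ℕ → ℕ | IsSRT 2 (m + 1) (rectPart d w) (zeroPart d w) E}.ncard =
    {b | Dom d w m b}.ncard := by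
  rw [← Set.ncard_image_of_injOn (dtab_inj m hm)]
  congr 1
  ext E
  simp only [Set.mem_image, Set.mem_ofPred_eq]
  constructor
  · intro hE
    have hch : ∀ k, ∃ pq : (ℕ × ℕ) × (ℕ × ℕ), k ≤ m →
        ({p : ℕ × ℕ | InShape (rectPart d w) (zeroPart d w) p.1 p.2 ∧ E p.1 p.2 = k + 1} =
          {pq.1, pq.2}) ∧ (pq.2 = (pq.1.1 + 1, pq.1.2) ∨ pq.2 = (pq.1.1, pq.1.2 + 1)) := by
      intro k
      by_cases hk : k ≤ m
      · obtain ⟨p, q, hpq⟩ := ribbon_two (hE.2.2.2.2 (k + 1) (by omega) (by omega))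
        exact ⟨(p, q), fun _ => hpq⟩
      · exact ⟨((0, 0), (0, 0)), fun h => absurd h hk⟩
    choose f hf using hch
    let b : Wd := fun k => if k < d * w then
      (if k % 2 = 0 then (f (k / 2)).1 else (f (k / 2)).2) else (0, 0)
    have be : ∀ q, q ≤ m → b (2 * q) = (f q).1 := by
      intro q hq
      simp only [b]
      rw [if_pos (by omega), if_pos (by omega), show 2 * q / 2 = q by omega]
    have bo : ∀ q, q ≤ m → b (2 * q + 1) = (f q).2 := by
      intro q hq
      simp only [b]
      rw [if_pos (by omega), if_neg (by omega), show (2 * q + 1) / 2 = q by omega]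
    have bm : ∀ k, k < d * w → ((b k).1 < d ∧ (b k).2 < w) ∧ E (b k).1 (b k).2 = k / 2 + 1 := by
      intro k hk
      have hs := (hf (k / 2) (by omega)).1
      have : b k ∈ ({(f (k / 2)).1, (f (k / 2)).2} : Set (ℕ × ℕ)) := by
        simp only [b]
        rw [if_pos hk]
        split_ifs <;> simp
      rw [← hs] at this
      exact ⟨(inShape_iff _ _).1 this.1, this.2⟩
    have hl : Lin d w b := by
      refine ⟨fun k hk => if_neg (by omega), fun k hk => (bm k hk).1, ?_, ?_⟩
      · intro r s hr hs
        have hr2 := hE.2.1 r s ((inShape_iff _ _).2 ⟨hr, hs⟩)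
        have hs2 := (hf (E r s - 1) (by omega)).1
        have : (r, s) ∈ {p : ℕ × ℕ | InShape (rectPart d w) (zeroPart d w) p.1 p.2 ∧
            E p.1 p.2 = E r s - 1 + 1} := ⟨(inShape_iff _ _).2 ⟨hr, hs⟩, by simp only; omega⟩
        rw [hs2] at this
        rcases this with q | q
        · exact ⟨2 * (E r s - 1), by omega, by rw [be _ (by omega), q]⟩
        · exact ⟨2 * (E r s - 1) + 1, by omega, by rw [bo _ (by omega)]; exact q.symm⟩
      · intro i j hi hj h1 h2
        have mi := bm i hi
        have mj := bm j hj
        have := srt_mono hE h1 h2 mj.1.1 mj.1.2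
        by_contra hc
        obtain ⟨q, rfl, rfl⟩ : ∃ q, i = 2 * q + 1 ∧ j = 2 * q := ⟨j / 2, by omega, by omega⟩
        rw [be q (by omega), bo q (by omega)] at h1 h2
        rcases (hf q (by omega)).2 with e | e <;> rw [e] at h1 h2 <;> simp at h1 h2
    refine ⟨b, ⟨hl, ?_⟩, ?_⟩
    · intro k hk
      rw [be k hk, bo k hk]
      rcases (hf k hk).2 with e | e <;> rw [e] <;> unfold ct <;> simp only <;> omega
    · funext r s
      unfold dtab
      by_cases hc : r < d ∧ s < w
      · obtain ⟨k, hk, ek⟩ := hl.surj r s hc.1 hc.2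
        have := (bm k hk).2
        rw [ek] at this
        rw [hl.tab_at hk ek, this]
        omega
      · rw [hl.tab_out hc, hE.1 r s (by rwa [inShape_iff])]
  · rintro ⟨b, ⟨h, hc⟩, rfl⟩
    have le : ∀ i j i' j', i' < d → j' < w → i ≤ i' → j ≤ j' →
        dtab d w b i j ≤ dtab d w b i' j' := by
      intro i j i' j' h1 h2 h3 h4
      obtain ⟨k, hk, ek⟩ := h.surj i j (by omega) (by omega)
      obtain ⟨l, hl, el⟩ := h.surj i' j' h1 h2
      unfold dtab
      rw [h.tab_at hk ek, h.tab_at hl el]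
      have := h.mono k l hk hl (by rw [ek, el]; exact h3) (by rw [ek, el]; exact h4)
      omega
    simp only [IsSRT, inShape_iff]
    refine ⟨?_, ?_, ?_, ?_, ?_⟩
    · intro i j hij; unfold dtab; rw [h.tab_out hij]
    · intro i j hij
      obtain ⟨k, hk, ek⟩ := h.surj i j hij.1 hij.2
      unfold dtab
      rw [h.tab_at hk ek]; omega
    · intro i j j' h1 h2 h3
      exact le _ _ _ _ h2.1 h2.2 le_rfl h3
    · intro i i' j h1 h2 h3
      exact le _ _ _ _ h2.1 h2.2 h3 le_rfl
    · intro k h1 h2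
      have cl := h.close (i := 2 * (k - 1)) (by omega) (hc (k - 1) (by omega))
      have adj : BoxAdj (b (2 * (k - 1))) (b (2 * (k - 1) + 1)) := by unfold BoxAdj; omega
      convert ribbon_pair adj using 1
      ext ⟨i, j⟩
      simp only [Set.mem_ofPred_eq, Set.mem_insert_iff, Set.mem_singleton_iff]
      constructor
      · rintro ⟨hij, e⟩
        obtain ⟨l, hl, el⟩ := h.surj i j hij.1 hij.2
        unfold dtab at e
        rw [h.tab_at hl el] at e
        rw [← el]
        have : l = 2 * (k - 1) ∨ l = 2 * (k - 1) + 1 := by omega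
        rcases this with q | q
        · left; rw [q]
        · right; rw [q]
      · have gen : ∀ l, l < d * w → l / 2 + 1 = k → (i, j) = b l →
            (i < d ∧ j < w) ∧ dtab d w b i j = k := by
          intro l hl hlk e
          have := h.mem l hl
          rw [← e] at this
          refine ⟨this, ?_⟩
          unfold dtab
          rw [h.tab_at hl e.symm]; omega
        rintro (e | e)
        · exact gen _ (by omega) (by omega) e
        · exact gen _ (by omega) (by omega) e

theorem final (d w ℓ : ℕ) (hN : 0 < d * w) (hl : 2 * ℓ = d * w) :
    {E : ℕ → ℕ → ℕ | IsSYT d w E ∧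
      RotInvariant (d * w) (rectPart d w) (zeroPart d w) E}.ncard =
    {E : ℕ → ℕ → ℕ | IsSRT 2 ℓ (rectPart d w) (zeroPart d w) E}.ncard := by
  obtain ⟨m, rfl⟩ : ∃ m, ℓ = m + 1 := ⟨ℓ - 1, by omega⟩
  have hm : d * w = 2 * m + 2 := by omega
  rw [syt_card, card_eq m hm, srt_card m hm]
  rfl

end DomRot

/-- Suppose `N = d(n-d)` is even (`N = 2ℓ`).  The number of
rotationally-invariant standard Young tableaux of rectangular shape `(n-d)^d`
equals the number of standard `2`-ribbon (domino) tableaux of shape `(n-d)^d`. -/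
theorem statement15 (d n ℓ : ℕ) (hd : 0 < d) (hdn : d < n)
    (hl : 2 * ℓ = d * (n - d)) :
    Set.ncard {E : ℕ → ℕ → ℕ |
        IsSYT d (n - d) E ∧
        RotInvariant (d * (n - d)) (rectPart d (n - d)) (zeroPart d (n - d)) E} =
      Set.ncard {E : ℕ → ℕ → ℕ |
        IsSRT 2 ℓ (rectPart d (n - d)) (zeroPart d (n - d)) E} := by
  exact DomRot.final d (n - d) ℓ (Nat.mul_pos hd (by omega)) hl
end

section
/- Let h be a C_r-fixed polynomial and X_{λ/μ} an h-compatible Richardson variety. If λ and μ do not have the same r-core, then X^r_{λ/μ}(h) := X_{λ/μ} ∩ X^r ∩ Wr^{−1}(h) is empty; moreover, in this case there are no standard r-ribbon tableaux of shape λ/μ. -/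
open Polynomial

lemma aux_step (A : Submodule ℂ (Polynomial ℂ)) [FiniteDimensional ℂ A]
    (φ : Polynomial ℂ →ₗ[ℂ] ℂ) (P : Prop) [Decidable P] (hP : P ↔ ∃ v ∈ A, φ v ≠ 0) :
    Module.finrank ℂ A = Module.finrank ℂ ↥(A ⊓ LinearMap.ker φ) + if P then 1 else 0 := by
  have h1 := LinearMap.finrank_range_add_finrank_ker (φ.domRestrict A)
  have h2 : Module.finrank ℂ (LinearMap.ker (φ.domRestrict A)) =
      Module.finrank ℂ ↥(A ⊓ LinearMap.ker φ) := by
    have : (LinearMap.ker (φ.domRestrict A)).map A.subtype = A ⊓ LinearMap.ker φ := by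
      ext v
      simp [LinearMap.domRestrict, and_comm]
    rw [← this]
    exact (Submodule.equivMapOfInjective _ A.injective_subtype _).finrank_eq
  have h3 : Module.finrank ℂ (LinearMap.range (φ.domRestrict A)) = if P then 1 else 0 := by
    split_ifs with h
    · obtain ⟨v, hv, hv0⟩ := hP.1 h
      have : LinearMap.range (φ.domRestrict A) = ⊤ := by
        rw [LinearMap.range_eq_top]
        apply LinearMap.surjective
        intro h0
        apply hv0
        have := LinearMap.congr_fun h0 ⟨v, hv⟩
        simpa using this
      rw [this]; simp
    · have : φ.domRestrict A = 0 := by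
        ext ⟨v, hv⟩
        by_contra hne
        exact h (hP.2 ⟨v, hv, by simpa using hne⟩)
      rw [this]; simp
  omega

/-- degrees of nonzero members of `V` -/
def IsDegOf (V : Submodule ℂ (Polynomial ℂ)) (a : ℕ) : Prop :=
  ∃ v ∈ V, v.coeff a ≠ 0 ∧ ∀ b, a < b → v.coeff b = 0

/-- orders at zero of nonzero members of `V` -/
def IsOrdOf (V : Submodule ℂ (Polynomial ℂ)) (a : ℕ) : Prop :=
  ∃ v ∈ V, v.coeff a ≠ 0 ∧ ∀ b, b < a → v.coeff b = 0

/-- multiples of `X ^ k` -/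
noncomputable def ordGE (k : ℕ) : Submodule ℂ (Polynomial ℂ) :=
  Submodule.restrictScalars ℂ (Ideal.span {(Polynomial.X : Polynomial ℂ) ^ k})

lemma mem_ordGE (k : ℕ) (p : Polynomial ℂ) : p ∈ ordGE k ↔ ∀ b < k, p.coeff b = 0 := by
  rw [ordGE, Submodule.restrictScalars_mem, Ideal.mem_span_singleton, Polynomial.X_pow_dvd_iff]

lemma mem_degLT (k : ℕ) (p : Polynomial ℂ) :
    p ∈ Polynomial.degreeLT ℂ k ↔ ∀ b, k ≤ b → p.coeff b = 0 := by
  rw [Polynomial.mem_degreeLT, Polynomial.degree_lt_iff_coeff_zero]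

open Classical in
lemma degs_count (V : Submodule ℂ (Polynomial ℂ)) [FiniteDimensional ℂ V] (k : ℕ) :
    Module.finrank ℂ ↥(V ⊓ Polynomial.degreeLT ℂ k) =
      ((Finset.range k).filter (IsDegOf V)).card := by
  induction k with
  | zero =>
    have : V ⊓ Polynomial.degreeLT ℂ 0 = ⊥ := by
      rw [eq_bot_iff]
      intro v hv
      have := (mem_degLT _ _).1 hv.2
      simp only [Submodule.mem_bot]
      ext b; simpa using this b (Nat.zero_le _)
    rw [this]; simp
  | succ k ih =>
    have h := aux_step (V ⊓ Polynomial.degreeLT ℂ (k+1)) (Polynomial.lcoeff ℂ k) (IsDegOf V k)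
      (by
        constructor
        · rintro ⟨v, hv, h1, h2⟩
          exact ⟨v, ⟨hv, (mem_degLT _ _).2 fun b hb => h2 b hb⟩, h1⟩
        · rintro ⟨v, hv, h1⟩
          exact ⟨v, hv.1, h1, fun b hb => (mem_degLT _ _).1 hv.2 b hb⟩)
    have h2 : V ⊓ Polynomial.degreeLT ℂ (k+1) ⊓ LinearMap.ker (Polynomial.lcoeff ℂ k)
        = V ⊓ Polynomial.degreeLT ℂ k := by
      ext v
      simp only [Submodule.mem_inf, mem_degLT, LinearMap.mem_ker, Polynomial.lcoeff_apply]
      constructor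
      · rintro ⟨⟨a, b⟩, c⟩
        refine ⟨a, fun t ht => ?_⟩
        rcases Nat.eq_or_lt_of_le ht with rfl | ht
        · exact c
        · exact b t ht
      · rintro ⟨a, b⟩
        exact ⟨⟨a, fun t ht => b t (by omega)⟩, b k le_rfl⟩
    rw [h, h2, ih, Finset.range_add_one, Finset.filter_insert]
    split_ifs with hk
    · rw [Finset.card_insert_of_notMem (by simp)]
    · rfl

open Classical in
lemma ords_count (V : Submodule ℂ (Polynomial ℂ)) [FiniteDimensional ℂ V] (k : ℕ) :
    Module.finrank ℂ V = Module.finrank ℂ ↥(V ⊓ ordGE k) +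
      ((Finset.range k).filter (IsOrdOf V)).card := by
  induction k with
  | zero =>
    have : V ⊓ ordGE 0 = V := by
      rw [inf_eq_left]
      intro v hv
      rw [mem_ordGE]; intro b hb; omega
    rw [this]; simp
  | succ k ih =>
    have h := aux_step (V ⊓ ordGE k) (Polynomial.lcoeff ℂ k) (IsOrdOf V k)
      (by
        constructor
        · rintro ⟨v, hv, h1, h2⟩
          exact ⟨v, ⟨hv, (mem_ordGE _ _).2 fun b hb => h2 b hb⟩, h1⟩
        · rintro ⟨v, hv, h1⟩
          exact ⟨v, hv.1, h1, fun b hb => (mem_ordGE _ _).1 hv.2 b hb⟩)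
    have h2 : V ⊓ ordGE k ⊓ LinearMap.ker (Polynomial.lcoeff ℂ k) = V ⊓ ordGE (k+1) := by
      ext v
      simp only [Submodule.mem_inf, mem_ordGE, LinearMap.mem_ker, Polynomial.lcoeff_apply]
      constructor
      · rintro ⟨⟨a, b⟩, c⟩
        refine ⟨a, fun t ht => ?_⟩
        rcases Nat.eq_or_lt_of_le (Nat.le_of_lt_succ ht) with rfl | ht
        · exact c
        · exact b t ht
      · rintro ⟨a, b⟩
        exact ⟨⟨a, fun t ht => b t (by omega)⟩, b k (by omega)⟩
    rw [h2] at h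
    rw [ih, h, Finset.range_add_one, Finset.filter_insert]
    split_ifs with hk
    · rw [Finset.card_insert_of_notMem (by simp)]; omega
    · rfl

open Classical in
lemma degs_card (n : ℕ) (V : Submodule ℂ (Polynomial ℂ)) [FiniteDimensional ℂ V]
    (hV : V ≤ Polynomial.degreeLT ℂ n) :
    ((Finset.range n).filter (IsDegOf V)).card = Module.finrank ℂ V := by
  rw [← degs_count, inf_eq_left.2 hV]

open Classical in
lemma ords_card (n : ℕ) (V : Submodule ℂ (Polynomial ℂ)) [FiniteDimensional ℂ V]
    (hV : V ≤ Polynomial.degreeLT ℂ n) :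
    ((Finset.range n).filter (IsOrdOf V)).card = Module.finrank ℂ V := by
  have : V ⊓ ordGE n = ⊥ := by
    rw [eq_bot_iff]
    rintro v ⟨hv, hv2⟩
    simp only [Submodule.mem_bot]
    ext b
    rcases lt_or_ge b n with h | h
    · simpa using (mem_ordGE _ _).1 hv2 b h
    · simpa using (mem_degLT _ _).1 (hV hv) b h
  rw [ords_count V n, this]; simp

/-! ### Wronskian -/

lemma wronsk_change (d : ℕ) (f g : Fin d → Polynomial ℂ)
    (h : ∀ i, f i ∈ Submodule.span ℂ (Set.range g)) :
    ∃ a : ℂ, wronskDet d f = Polynomial.C a * wronskDet d g := by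
  have h' : ∀ i, ∃ c : Fin d → ℂ, ∑ j, c j • g j = f i := fun i =>
    (Submodule.mem_span_range_iff_exists_fun ℂ).1 (h i)
  choose c hc using h'
  refine ⟨(Matrix.of c).det, ?_⟩
  unfold wronskDet
  have hdet : Polynomial.C (Matrix.of c).det = ((Matrix.of c).map Polynomial.C).det := by
    rw [RingHom.map_det]; rfl
  rw [hdet, ← Matrix.det_mul]
  congr 1
  ext1 i j
  simp only [Matrix.of_apply, Matrix.mul_apply, Matrix.map_apply]
  rw [← hc i]
  have : ∀ (k : ℕ) , (fun p : Polynomial ℂ => Polynomial.derivative p)^[k] (∑ t, c i t • g t)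
      = ∑ t, Polynomial.C (c i t) * (fun p : Polynomial ℂ => Polynomial.derivative p)^[k] (g t) := by
    intro k
    change (Polynomial.derivative)^[k] _ = _
    rw [Polynomial.iterate_derivative_sum]
    refine Finset.sum_congr rfl fun t _ => ?_
    rw [Polynomial.smul_eq_C_mul, Polynomial.iterate_derivative_C_mul]
  exact this j

lemma wronsk_deg (d : ℕ) (g : Fin d → Polynomial ℂ) (δ : Fin d → ℕ)
    (hg : ∀ i b, δ i < b → (g i).coeff b = 0) (hne : wronskDet d g ≠ 0) :
    (wronskDet d g).natDegree + ∑ i : Fin d, (i : ℕ) ≤ ∑ i, δ i := by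
  have hdeg : ∀ i, (g i).natDegree ≤ δ i := fun i =>
    Polynomial.natDegree_le_iff_coeff_eq_zero.2 (fun b hb => hg i b hb)
  have key : (wronskDet d g).natDegree ≤ ∑ i, δ i - ∑ i : Fin d, (i : ℕ) ∧
      (∑ i : Fin d, (i : ℕ) ≤ ∑ i, δ i) := by
    unfold wronskDet at hne ⊢
    rw [← Matrix.det_transpose, Matrix.det_apply] at hne ⊢
    have term : ∀ σ : Equiv.Perm (Fin d),
        (∏ i, (Matrix.of fun i j : Fin d =>
          (fun p : Polynomial ℂ => Polynomial.derivative p)^[(j : ℕ)] (g i)).transpose (σ i) i) ≠ 0 →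
        (∏ i, (Matrix.of fun i j : Fin d =>
          (fun p : Polynomial ℂ => Polynomial.derivative p)^[(j : ℕ)] (g i)).transpose (σ i) i).natDegree
          + ∑ i : Fin d, (i : ℕ) ≤ ∑ i, δ i := by
      intro σ hσ
      rw [← Equiv.sum_comp σ (fun i : Fin d => (i : ℕ))]
      rw [Polynomial.natDegree_prod _ _ (fun i hi h0 => hσ (Finset.prod_eq_zero hi h0)),
        ← Finset.sum_add_distrib]
      refine Finset.sum_le_sum fun i hi => ?_
      have hi0 := (Finset.prod_ne_zero_iff.1 hσ) i hi
      simp only [Matrix.transpose_apply, Matrix.of_apply] at hi0 ⊢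
      change (Polynomial.derivative)^[_] (g i) ≠ 0 at hi0
      change ((Polynomial.derivative)^[_] (g i)).natDegree + _ ≤ _
      have h1 := Polynomial.natDegree_iterate_derivative (g i) (σ i : ℕ)
      have h2 : (σ i : ℕ) ≤ (g i).natDegree := by
        by_contra hlt
        exact hi0 (Polynomial.iterate_derivative_eq_zero (by omega))
      have := hdeg i
      omega
    constructor
    · refine Polynomial.natDegree_sum_le_of_forall_le _ _ fun σ _ => ?_
      refine (Polynomial.natDegree_smul_le _ _).trans ?_
      by_cases h0 : (∏ i, (Matrix.of fun i j : Fin d =>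
          (fun p : Polynomial ℂ => Polynomial.derivative p)^[(j : ℕ)] (g i)).transpose (σ i) i) = 0
      · rw [h0]; simp
      · have := term σ h0
        omega
    · obtain ⟨σ, _, hσ⟩ := Finset.exists_ne_zero_of_sum_ne_zero hne
      have := term σ (fun h0 => hσ (by rw [h0]; simp))
      omega
  omega

lemma wronsk_ord (d : ℕ) (g : Fin d → Polynomial ℂ) (δ : Fin d → ℕ)
    (hg : ∀ i b, b < δ i → (g i).coeff b = 0) :
    (Polynomial.X : Polynomial ℂ) ^ (∑ i, δ i - ∑ i : Fin d, (i : ℕ)) ∣ wronskDet d g := by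
  unfold wronskDet
  rw [← Matrix.det_transpose, Matrix.det_apply]
  refine Finset.dvd_sum fun σ _ => ?_
  rw [Units.smul_def, zsmul_eq_mul]
  refine Dvd.dvd.mul_left ?_ _
  · have h1 : (Polynomial.X : Polynomial ℂ) ^ (∑ i, δ i - ∑ i : Fin d, (i : ℕ)) ∣
        ∏ i, (Polynomial.X : Polynomial ℂ) ^ (δ i - (σ i : ℕ)) := by
      rw [Finset.prod_pow_eq_pow_sum]
      apply pow_dvd_pow
      rw [← Equiv.sum_comp σ (fun i : Fin d => (i : ℕ)), Nat.sub_le_iff_le_add,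
        ← Finset.sum_add_distrib]
      exact Finset.sum_le_sum fun i _ => by omega
    refine h1.trans (Finset.prod_dvd_prod_of_dvd _ _ fun i _ => ?_)
    simp only [Matrix.transpose_apply, Matrix.of_apply]
    change _ ∣ (Polynomial.derivative)^[_] (g i)
    rw [Polynomial.X_pow_dvd_iff]
    intro b hb
    rw [Polynomial.coeff_iterate_derivative, hg i _ (by omega)]
    simp

/-! ### Comparing with an index sequence -/

open Classical in
lemma degs_eq (n d : ℕ) (x : Submodule ℂ (Polynomial ℂ)) (hx : x ≤ Polynomial.degreeLT ℂ n)
    (hd : Module.finrank ℂ x = d) [FiniteDimensional ℂ x] (J : Fin d → ℕ)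
    (hJ : ∀ i : Fin d, (i : ℕ) + 1 ≤ Module.finrank ℂ ↥(x ⊓ Polynomial.degreeLT ℂ (J i + 1)))
    (f : Fin d → Polynomial ℂ) (hf : ∀ i, f i ∈ x) (hW : wronskDet d f ≠ 0)
    (hs : ∑ i, J i ≤ (wronskDet d f).natDegree + ∑ i : Fin d, (i : ℕ)) :
    (Finset.range n).filter (IsDegOf x) = Finset.univ.image J := by
  set D := (Finset.range n).filter (IsDegOf x) with hD
  have hcard : D.card = d := by rw [hD, degs_card n x hx, hd]
  set δ := D.orderEmbOfFin hcard with hδ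
  have hmem : ∀ i, IsDegOf x (δ i) := fun i =>
    (Finset.mem_filter.1 (D.orderEmbOfFin_mem hcard i)).2
  have hle : ∀ i, δ i ≤ J i := by
    intro i
    by_contra hlt
    have h1 := hJ i
    rw [degs_count] at h1
    have : (Finset.range (J i + 1)).filter (IsDegOf x) ⊆ (Finset.Iio i).image δ := by
      intro a ha
      rw [Finset.mem_filter, Finset.mem_range] at ha
      have haD : a ∈ D := by
        rw [hD, Finset.mem_filter, Finset.mem_range]
        refine ⟨?_, ha.2⟩
        obtain ⟨v, hv, h1, h2⟩ := ha.2
        by_contra hn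
        exact h1 ((mem_degLT _ _).1 (hx hv) a (by omega))
      have : a ∈ Set.range δ := by rw [hδ, Finset.range_orderEmbOfFin]; exact haD
      obtain ⟨t, rfl⟩ := this
      rw [Finset.mem_image]
      refine ⟨t, ?_, rfl⟩
      rw [Finset.mem_Iio]
      exact δ.lt_iff_lt.1 (by omega)
    have h2 := (Finset.card_le_card this).trans Finset.card_image_le
    rw [Fin.card_Iio] at h2
    omega
  choose g hgx hg1 hg2 using hmem
  have hspan : Submodule.span ℂ (Set.range g) = x := by
    have hsub : Submodule.span ℂ (Set.range g) ≤ x := by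
      rw [Submodule.span_le]; rintro _ ⟨i, rfl⟩; exact hgx i
    have : FiniteDimensional ℂ (Submodule.span ℂ (Set.range g)) :=
      Submodule.finiteDimensional_of_le hsub
    apply Submodule.eq_of_le_of_finrank_le hsub
    rw [← degs_card n x hx, ← degs_card n _ (hsub.trans hx)]
    apply Finset.card_le_card
    intro a ha
    have : a ∈ Set.range δ := by rw [hδ, Finset.range_orderEmbOfFin]; exact ha
    obtain ⟨t, rfl⟩ := this
    rw [Finset.mem_filter]
    exact ⟨(Finset.mem_filter.1 ha).1, g t, Submodule.subset_span ⟨t, rfl⟩, hg1 t, hg2 t⟩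
  obtain ⟨a, ha⟩ := wronsk_change d f g (fun i => by rw [hspan]; exact hf i)
  have hg0 : wronskDet d g ≠ 0 := by
    intro h0; rw [h0, mul_zero] at ha; exact hW ha
  have h3 := wronsk_deg d g δ hg2 hg0
  have h4 : (wronskDet d f).natDegree ≤ (wronskDet d g).natDegree := by
    rw [ha]; exact Polynomial.natDegree_C_mul_le _ _
  have h5 : ∑ i, δ i = ∑ i, J i :=
    le_antisymm (Finset.sum_le_sum fun i _ => hle i) (by omega)
  have h6 := (Finset.sum_eq_sum_iff_of_le (fun i _ => hle i)).1 h5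
  have h7 : (δ : Fin d → ℕ) = J := funext fun i => h6 i (Finset.mem_univ _)
  rw [← h7]
  apply Finset.coe_injective
  rw [Finset.coe_image, Finset.coe_univ, Set.image_univ, hδ, Finset.range_orderEmbOfFin]

open Classical in
lemma ords_eq (n d : ℕ) (x : Submodule ℂ (Polynomial ℂ)) (hx : x ≤ Polynomial.degreeLT ℂ n)
    (hd : Module.finrank ℂ x = d) [FiniteDimensional ℂ x] (J : Fin d → ℕ)
    (hJ : ∀ i : Fin d, d - (i : ℕ) ≤ Module.finrank ℂ ↥(x ⊓ ordGE (J i)))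
    (f : Fin d → Polynomial ℂ) (hf : ∀ i, f i ∈ x) (hW : wronskDet d f ≠ 0)
    (hs : (wronskDet d f).rootMultiplicity 0 + ∑ i : Fin d, (i : ℕ) ≤ ∑ i, J i) :
    (Finset.range n).filter (IsOrdOf x) = Finset.univ.image J := by
  set D := (Finset.range n).filter (IsOrdOf x) with hD
  have hcard : D.card = d := by rw [hD, ords_card n x hx, hd]
  set δ := D.orderEmbOfFin hcard with hδ
  have hmem : ∀ i, IsOrdOf x (δ i) := fun i =>
    (Finset.mem_filter.1 (D.orderEmbOfFin_mem hcard i)).2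
  have hle : ∀ i, J i ≤ δ i := by
    intro i
    by_contra hlt
    have h1 := hJ i
    have h0 := ords_count x (J i)
    have : (Finset.Iic i).image δ ⊆ (Finset.range (J i)).filter (IsOrdOf x) := by
      intro a ha
      obtain ⟨t, ht, rfl⟩ := Finset.mem_image.1 ha
      rw [Finset.mem_filter, Finset.mem_range]
      have := δ.le_iff_le.2 (Finset.mem_Iic.1 ht)
      exact ⟨by omega, hmem t⟩
    have h2 := Finset.card_le_card this
    rw [Finset.card_image_of_injective _ δ.injective, Fin.card_Iic] at h2
    have := i.2
    omega
  choose g hgx hg1 hg2 using hmem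
  have hspan : Submodule.span ℂ (Set.range g) = x := by
    have hsub : Submodule.span ℂ (Set.range g) ≤ x := by
      rw [Submodule.span_le]; rintro _ ⟨i, rfl⟩; exact hgx i
    have : FiniteDimensional ℂ (Submodule.span ℂ (Set.range g)) :=
      Submodule.finiteDimensional_of_le hsub
    apply Submodule.eq_of_le_of_finrank_le hsub
    rw [← ords_card n x hx, ← ords_card n _ (hsub.trans hx)]
    apply Finset.card_le_card
    intro a ha
    have : a ∈ Set.range δ := by rw [hδ, Finset.range_orderEmbOfFin]; exact ha
    obtain ⟨t, rfl⟩ := this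
    rw [Finset.mem_filter]
    exact ⟨(Finset.mem_filter.1 ha).1, g t, Submodule.subset_span ⟨t, rfl⟩, hg1 t, hg2 t⟩
  obtain ⟨a, ha⟩ := wronsk_change d f g (fun i => by rw [hspan]; exact hf i)
  have h3 := wronsk_ord d g δ hg2
  have h4 : ∑ i, δ i - ∑ i : Fin d, (i : ℕ) ≤ (wronskDet d f).rootMultiplicity 0 := by
    rw [Polynomial.le_rootMultiplicity_iff hW]
    simpa using h3.trans (ha ▸ Dvd.intro_left _ rfl)
  have h5 : ∑ i, J i = ∑ i, δ i :=
    le_antisymm (Finset.sum_le_sum fun i _ => hle i) (by omega)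
  have h6 := (Finset.sum_eq_sum_iff_of_le (fun i _ => hle i)).1 h5
  have h7 : J = (δ : Fin d → ℕ) := funext fun i => h6 i (Finset.mem_univ _)
  rw [h7]
  apply Finset.coe_injective
  rw [Finset.coe_image, Finset.coe_univ, Set.image_univ, hδ, Finset.range_orderEmbOfFin]

/-! ### Cyclic symmetry -/

lemma rotMap_coeff (c : ℂ) (p : Polynomial ℂ) (a : ℕ) :
    (rotMap c p).coeff a = c ^ a * p.coeff a := by
  have : rotMap c p = p.comp (Polynomial.C c * Polynomial.X) := by
    simp [rotMap, Polynomial.aeval_def, Polynomial.comp, Polynomial.eval₂_eq_sum,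
      Polynomial.algebraMap_eq]
  rw [this, Polynomial.comp_C_mul_X_coeff, mul_comm]

lemma proj_mem (r : ℕ) (hr : 1 ≤ r) (x : Submodule ℂ (Polynomial ℂ)) (hx : CrFixed r x)
    (k : ℕ) (p : Polynomial ℂ) (hp : p ∈ x) :
    ∃ q ∈ x, ∀ a, q.coeff a = if a % r = k % r then p.coeff a else 0 := by
  set ζ : ℂ := Complex.exp (-(2 * (Real.pi : ℂ) * Complex.I) / (r : ℂ)) with hζ
  have hprim : IsPrimitiveRoot ζ r := by
    have := (Complex.isPrimitiveRoot_exp r (by omega)).inv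
    rwa [← Complex.exp_neg, ← neg_div] at this
  have hζ0 : ζ ≠ 0 := Complex.exp_ne_zero _
  have hpow : ∀ j : ℕ, Complex.exp (-(2 * (Real.pi : ℂ) * Complex.I * (j : ℂ)) / (r : ℂ)) = ζ ^ j := by
    intro j
    rw [hζ, ← Complex.exp_nat_mul]; congr 1; ring
  have hr0 : (r : ℂ) ≠ 0 := by exact_mod_cast (by omega : r ≠ 0)
  refine ⟨∑ j : Fin r, ((r : ℂ)⁻¹ * (ζ ^ (j : ℕ))⁻¹ ^ k) • rotMap (ζ ^ (j : ℕ)) p, ?_, ?_⟩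
  · refine Submodule.sum_mem _ fun j _ => Submodule.smul_mem _ _ ?_
    have := hx j
    rw [hpow] at this
    rw [← this]
    exact Submodule.mem_map_of_mem hp
  · intro a
    rw [Polynomial.finsetSum_coeff]
    have h1 : ∀ j : Fin r, (((r : ℂ)⁻¹ * (ζ ^ (j : ℕ))⁻¹ ^ k) • rotMap (ζ ^ (j : ℕ)) p).coeff a
        = (r : ℂ)⁻¹ * p.coeff a * (ζ ^ a * (ζ ^ k)⁻¹) ^ (j : ℕ) := by
      intro j
      rw [Polynomial.coeff_smul, rotMap_coeff, smul_eq_mul, mul_pow, inv_pow, inv_pow,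
        ← pow_mul, ← pow_mul, ← pow_mul, ← pow_mul, mul_comm a, mul_comm k]
      ring
    rw [Finset.sum_congr rfl fun j _ => h1 j, ← Finset.mul_sum,
      Fin.sum_univ_eq_sum_range (fun j => (ζ ^ a * (ζ ^ k)⁻¹) ^ j) r]
    have h2 : (ζ ^ a * (ζ ^ k)⁻¹ = 1) ↔ a % r = k % r := by
      rw [mul_inv_eq_one₀ (pow_ne_zero _ hζ0), ← pow_mod_orderOf ζ a, ← pow_mod_orderOf ζ k,
        ← hprim.eq_orderOf]
      exact ⟨fun h => hprim.pow_inj (Nat.mod_lt _ hr) (Nat.mod_lt _ hr) h, fun h => by rw [h]⟩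
    split_ifs with h
    · rw [h2.2 h]; simp; field_simp
    · have hne : ζ ^ a * (ζ ^ k)⁻¹ ≠ 1 := fun h' => h (h2.1 h')
      have h3 := mul_geom_sum (ζ ^ a * (ζ ^ k)⁻¹) r
      have h4 : (ζ ^ a * (ζ ^ k)⁻¹) ^ r = 1 := by
        rw [mul_pow, inv_pow, ← pow_mul, ← pow_mul, mul_comm a, mul_comm k, pow_mul, pow_mul,
          hprim.pow_eq_one]; simp
      rw [h4, sub_self] at h3
      rcases mul_eq_zero.1 h3 with h5 | h5
      · exact absurd (sub_eq_zero.1 h5) hne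
      · rw [h5, mul_zero]

/-- polynomials with exponents in one residue class -/
noncomputable def resSub (r k : ℕ) : Submodule ℂ (Polynomial ℂ) where
  carrier := {p | ∀ a, a % r ≠ k % r → p.coeff a = 0}
  add_mem' := by
    intro p q hp hq a ha
    rw [Polynomial.coeff_add, hp a ha, hq a ha, add_zero]
  zero_mem' := by intro a _; simp
  smul_mem' := by
    intro c p hp a ha
    rw [Polynomial.coeff_smul, hp a ha, smul_zero]

open Classical in
lemma res_count (n r : ℕ) (hr : 1 ≤ r) (x : Submodule ℂ (Polynomial ℂ)) [FiniteDimensional ℂ x]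
    (hxn : x ≤ Polynomial.degreeLT ℂ n) (hx : CrFixed r x) (k : ℕ) :
    (((Finset.range n).filter (IsDegOf x)).filter (fun a => a % r = k % r)).card =
    (((Finset.range n).filter (IsOrdOf x)).filter (fun a => a % r = k % r)).card := by
  have hle : x ⊓ resSub r k ≤ Polynomial.degreeLT ℂ n := inf_le_left.trans hxn
  have : FiniteDimensional ℂ ↥(x ⊓ resSub r k) :=
    Submodule.finiteDimensional_of_le inf_le_left
  trans Module.finrank ℂ ↥(x ⊓ resSub r k)
  · rw [← degs_card n _ hle]
    congr 1
    ext a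
    simp only [Finset.mem_filter, and_assoc]
    refine and_congr_right fun _ => ?_
    constructor
    · rintro ⟨⟨v, hv, h1, h2⟩, hk⟩
      obtain ⟨q, hq, hq2⟩ := proj_mem r hr x hx k v hv
      refine ⟨q, ⟨hq, fun b hb => by rw [hq2, if_neg hb]⟩, by rwa [hq2, if_pos hk], fun b hb => ?_⟩
      rw [hq2, h2 b hb, ite_self]
    · rintro ⟨v, hv, h1, h2⟩
      refine ⟨⟨v, hv.1, h1, h2⟩, ?_⟩
      by_contra hk
      exact h1 (hv.2 a hk)
  · rw [← ords_card n _ hle]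
    congr 1
    ext a
    simp only [Finset.mem_filter, and_assoc]
    refine and_congr_right fun _ => Iff.symm ?_
    constructor
    · rintro ⟨⟨v, hv, h1, h2⟩, hk⟩
      obtain ⟨q, hq, hq2⟩ := proj_mem r hr x hx k v hv
      refine ⟨q, ⟨hq, fun b hb => by rw [hq2, if_neg hb]⟩, by rwa [hq2, if_pos hk], fun b hb => ?_⟩
      rw [hq2, h2 b hb, ite_self]
    · rintro ⟨v, hv, h1, h2⟩
      refine ⟨⟨v, hv.1, h1, h2⟩, ?_⟩
      by_contra hk
      exact h1 (hv.2 a hk)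

/-! ### Abacus combinatorics -/

/-- the bead set -/
def beads {d w : ℕ} (lam : PartitionIn d w) : Finset ℕ :=
  Finset.univ.image (pluckerIndex lam)

lemma mem_beads {d w : ℕ} (lam : PartitionIn d w) (a : ℕ) :
    a ∈ beads lam ↔ ∃ t < d, a = lam.part t + (d - 1 - t) := by
  simp only [beads, Finset.mem_image, Finset.mem_univ, true_and, pluckerIndex]
  constructor
  · rintro ⟨i, rfl⟩
    have := i.2
    refine ⟨d - 1 - i, by omega, by omega⟩
  · rintro ⟨t, ht, rfl⟩
    refine ⟨⟨d - 1 - t, by omega⟩, ?_⟩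
    have : d - 1 - (d - 1 - t) = t := by omega
    simp only [this]; omega

lemma plucker_strictMono {d w : ℕ} (lam : PartitionIn d w) : StrictMono (pluckerIndex lam) := by
  intro i j hij
  have h1 : (i : ℕ) < j := hij
  have := lam.antitone (show d - 1 - (j : ℕ) ≤ d - 1 - (i : ℕ) by omega)
  simp only [pluckerIndex]; omega

lemma beads_card {d w : ℕ} (lam : PartitionIn d w) : (beads lam).card = d := by
  rw [beads, Finset.card_image_of_injective _ (plucker_strictMono lam).injective]; simp

lemma partitionIn_ext {d w : ℕ} {a b : PartitionIn d w} (h : a.part = b.part) : a = b := by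
  cases a; cases b; simp at h; subst h; rfl

lemma beads_inj {d w : ℕ} (lam mu : PartitionIn d w) (h : beads lam = beads mu) : lam = mu := by
  have h1 := Finset.orderEmbOfFin_unique (beads_card lam)
    (f := pluckerIndex lam) (fun i => by simp [beads]) (plucker_strictMono lam)
  have h2 := Finset.orderEmbOfFin_unique (beads_card lam)
    (f := pluckerIndex mu) (fun i => by rw [h]; simp [beads]) (plucker_strictMono mu)
  have h3 := h1.trans h2.symm
  apply partitionIn_ext
  funext t
  rcases lt_or_ge t d with ht | ht
  · have := congrFun h3 ⟨d - 1 - t, by omega⟩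
    simp only [pluckerIndex] at this
    have e : d - 1 - (d - 1 - t) = t := by omega
    rw [e] at this; omega
  · rw [lam.eq_zero t ht, mu.eq_zero t ht]

/-- A skew shape occupying rows `i..j`, with consecutive rows overlapping in one column,
is a ribbon. -/
lemma ribbon_of_rows {d w : ℕ} (r : ℕ) (lam nu : PartitionIn d w) (i j : ℕ) (hij : i ≤ j)
    (hj : j < d)
    (hout : ∀ t, t < i ∨ j < t → nu.part t = lam.part t)
    (hmid : ∀ t, i ≤ t → t < j → nu.part t + 1 = lam.part (t + 1))
    (hlast : nu.part j < lam.part j)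
    (hr : lam.part i + j = nu.part j + i + r) :
    IsRibbon r {p : ℕ × ℕ | InShape lam nu p.1 p.2} := by
  set S : Set (ℕ × ℕ) := {p : ℕ × ℕ | InShape lam nu p.1 p.2} with hS
  have hrow : ∀ p ∈ S, i ≤ p.1 ∧ p.1 ≤ j ∧ nu.part p.1 ≤ p.2 ∧ p.2 < lam.part p.1 := by
    rintro ⟨a, c⟩ ⟨h1, h2, h3⟩
    have : ¬ (a < i ∨ j < a) := fun h => by
      have := hout a h
      simp only at h2 h3
      omega
    simp only at h1 h2 h3 ⊢
    omega
  have hmem : ∀ a c, a < d → nu.part a ≤ c → c < lam.part a → (a, c) ∈ S :=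
    fun a c h1 h2 h3 => ⟨h1, h2, h3⟩
  have hp0 : (j, nu.part j) ∈ S := hmem _ _ hj le_rfl hlast
  have htop : (i, lam.part i - 1) ∈ S := by
    have := lam.antitone hij
    rcases Nat.eq_or_lt_of_le hij with rfl | h
    · exact hmem _ _ hj (by omega) (by omega)
    · have h1 := hmid i le_rfl h
      have h2 := lam.antitone (Nat.le_succ i)
      exact hmem _ _ (by omega) (by simp only [Nat.succ_eq_add_one] at h2; omega) (by omega)
  -- one step down
  have hstep : ∀ p ∈ S, p ≠ (j, nu.part j) → ∃ q ∈ S, BoxAdj p q ∧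
      q.2 + p.1 + 1 = p.2 + q.1 := by
    rintro ⟨a, c⟩ hp hne
    obtain ⟨h1, h2, h3, h4⟩ := hrow _ hp
    simp only at h1 h2 h3 h4
    rcases Nat.eq_or_lt_of_le h3 with h5 | h5
    · have haj : a < j := by
        rcases Nat.eq_or_lt_of_le h2 with rfl | h
        · exact absurd (by rw [h5]) hne
        · exact h
      have := hmid a h1 haj
      have h6 := nu.antitone (Nat.le_succ a)
      simp only [Nat.succ_eq_add_one] at h6
      exact ⟨(a + 1, c), hmem _ _ (by omega) (by omega) (by omega),
        Or.inr ⟨rfl, Or.inl rfl⟩, by simp only; omega⟩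
    · refine ⟨(a, c - 1), hmem _ _ (by omega) (by omega) (by omega),
        Or.inl ⟨rfl, Or.inr ?_⟩, ?_⟩ <;> simp only <;> omega
  have hsymm : ∀ u v, (u ∈ S ∧ v ∈ S ∧ BoxAdj u v) → (v ∈ S ∧ u ∈ S ∧ BoxAdj v u) := by
    rintro u v ⟨h1, h2, h3⟩
    refine ⟨h2, h1, ?_⟩
    unfold BoxAdj at h3 ⊢
    omega
  have hlow : ∀ p ∈ S, nu.part j + p.1 ≤ p.2 + j := by
    intro p hp
    obtain ⟨h1, h2, h3, h4⟩ := hrow _ hp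
    have := nu.antitone h2
    omega
  have hhigh : ∀ p ∈ S, p.2 + i < lam.part i + p.1 := by
    intro p hp
    obtain ⟨h1, h2, h3, h4⟩ := hrow _ hp
    have := lam.antitone h1
    omega
  have hconn : ∀ k : ℕ, ∀ p ∈ S, p.2 + j - p.1 = k →
      Relation.ReflTransGen (fun u v => u ∈ S ∧ v ∈ S ∧ BoxAdj u v) p (j, nu.part j) := by
    intro k
    induction k with
    | zero =>
      intro p hp hk
      by_cases hne : p = (j, nu.part j)
      · rw [hne]
      · obtain ⟨q, hq, h1, h2⟩ := hstep p hp hne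
        have := (hrow _ hp); have := (hrow _ hq)
        omega
    | succ k ih =>
      intro p hp hk
      by_cases hne : p = (j, nu.part j)
      · rw [hne]
      · obtain ⟨q, hq, h1, h2⟩ := hstep p hp hne
        have := (hrow _ hp); have := (hrow _ hq)
        exact Relation.ReflTransGen.head ⟨hp, hq, h1⟩ (ih q hq (by omega))
  refine ⟨?_, ?_, ?_⟩
  · have hinj : Set.InjOn (fun p : ℕ × ℕ => p.2 + j - p.1) S := by
      have main : ∀ p ∈ S, ∀ q ∈ S, p.2 + j - p.1 = q.2 + j - q.1 → ¬ p.1 < q.1 := by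
        intro p hp q hq h hlt
        have h1 := hrow _ hp
        have h2 := hrow _ hq
        have h3 := hmid p.1 h1.1 (by omega)
        have h4 := lam.antitone (show p.1 + 1 ≤ q.1 by omega)
        omega
      intro p hp q hq h
      simp only at h
      have a1 := main p hp q hq h
      have a2 := main q hq p hp h.symm
      have h1 := hrow _ hp
      have h2 := hrow _ hq
      exact Prod.ext (by omega) (by omega)
    rw [← hinj.ncard_image]
    have himg : (fun p : ℕ × ℕ => p.2 + j - p.1) '' S =
        ((Finset.Ico (nu.part j) (nu.part j + r) : Finset ℕ) : Set ℕ) := by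
      ext v
      simp only [Set.mem_image, Finset.coe_Ico, Set.mem_Ico]
      constructor
      · rintro ⟨p, hp, rfl⟩
        have h1 := hrow _ hp
        have h2 := hlow _ hp
        have h3 := hhigh _ hp
        omega
      · rintro ⟨h1, h2⟩
        have : ∀ s : ℕ, s < r → ∃ p ∈ S, p.2 + j - p.1 + s + 1 = nu.part j + r := by
          intro s
          induction s with
          | zero =>
            intro hs
            have h1 := hrow _ htop
            simp only at h1
            exact ⟨_, htop, by simp only; omega⟩
          | succ s ih =>
            intro hs
            obtain ⟨p, hp, hp2⟩ := ih (by omega)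
            have hne : p ≠ (j, nu.part j) := by
              rintro rfl
              simp only at hp2
              omega
            obtain ⟨q, hq, _, h2⟩ := hstep p hp hne
            have := (hrow _ hp); have := (hrow _ hq)
            exact ⟨q, hq, by omega⟩
        obtain ⟨p, hp, hp2⟩ := this (nu.part j + r - 1 - v) (by omega)
        exact ⟨p, hp, by omega⟩
    rw [himg, Set.ncard_coe_finset]; simp
  · intro p hp q hq
    refine (hconn _ p hp rfl).trans ?_
    have hs : Std.Symm (fun u v => u ∈ S ∧ v ∈ S ∧ BoxAdj u v) := ⟨hsymm⟩
    exact Relation.ReflTransGen.stdSymm.symm _ _ (hconn _ q hq rfl)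
  · rintro ⟨a, c, h1, _, _, h4⟩
    have b1 := hrow _ h1
    have b2 := hrow _ h4
    simp only at b1 b2
    have := hmid a (by omega) (by omega)
    omega

/-- moving a bead -/
lemma bead_move {d w : ℕ} (r : ℕ) (hr : 1 ≤ r) (lam : PartitionIn d w) (b : ℕ)
    (hb : b ∈ beads lam) (hbr : r ≤ b) (hb' : b - r ∉ beads lam) :
    ∃ nu : PartitionIn d w, RibbonStep r lam nu ∧
      beads nu = insert (b - r) ((beads lam).erase b) ∧ nu.size < lam.size := by
  obtain ⟨i, hi, hib⟩ := (mem_beads _ _).1 hb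
  set j := Nat.findGreatest (fun t => b - r < lam.part t + (d - 1 - t)) (d - 1) with hjdef
  have hij : i ≤ j := Nat.le_findGreatest (by omega) (by omega)
  have hjd : j ≤ d - 1 := Nat.findGreatest_le _
  have hj1 : b - r < lam.part j + (d - 1 - j) :=
    Nat.findGreatest_spec (P := fun t => b - r < lam.part t + (d - 1 - t)) (m := i)
      (by omega) (by omega)
  have hj2 : ∀ t, j < t → t < d → lam.part t + (d - 1 - t) < b - r := by
    intro t h1 h2
    have h3 := Nat.findGreatest_is_greatest (P := fun t => b - r < lam.part t + (d - 1 - t)) h1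
      (by omega)
    have h4 : b - r ≠ lam.part t + (d - 1 - t) := fun h => hb' ((mem_beads _ _).2 ⟨t, h2, h⟩)
    omega
  have hjge : d - 1 - j ≤ b - r := by
    rcases Nat.eq_or_lt_of_le hjd with h | h
    · omega
    · have := hj2 (j + 1) (by omega) (by omega); omega
  have hjn : ∀ t, j < t → lam.part t ≤ b - r - (d - 1 - j) := by
    intro t ht
    rcases lt_or_ge t d with h | h
    · have h1 := hj2 (j + 1) (by omega) (by omega)
      have h2 := lam.antitone (show j + 1 ≤ t by omega)
      omega
    · rw [lam.eq_zero t h]; omega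
  have hbig : ∀ t, t ≤ j → b - r - (d - 1 - j) + 1 ≤ lam.part t := by
    intro t ht
    have := lam.antitone ht
    omega
  clear_value j
  let nu : PartitionIn d w :=
    { part := fun t => if t < i then lam.part t else if t < j then lam.part (t + 1) - 1
        else if t = j then b - r - (d - 1 - j) else lam.part t
      antitone := by
        intro s t hst
        have h1 := lam.antitone hst
        have h2 := lam.antitone (show s + 1 ≤ t + 1 by omega)
        have h3 := lam.antitone (Nat.le_succ t)
        have h4 := hbig s
        have h5 := hbig (s + 1)
        have h6 := hjn t
        have h7 : s < t → lam.part t ≤ lam.part (s + 1) := fun h => lam.antitone h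
        simp only [Nat.succ_eq_add_one] at h3
        split_ifs <;> omega
      le_w := by
        intro t
        have h1 := lam.le_w t
        have h2 := lam.le_w (t + 1)
        have h3 := lam.le_w j
        split_ifs <;> omega
      eq_zero := by
        intro t ht
        have := lam.eq_zero t ht
        split_ifs <;> omega }
  have hnu : ∀ t, nu.part t = if t < i then lam.part t else if t < j then lam.part (t + 1) - 1
        else if t = j then b - r - (d - 1 - j) else lam.part t := fun t => rfl
  have hnuj : nu.part j = b - r - (d - 1 - j) := by
    rw [hnu, if_neg (by omega), if_neg (by omega), if_pos rfl]
  have hsub : SubPartition nu lam := by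
    intro t
    have h3 := lam.antitone (Nat.le_succ t)
    have h4 := hbig t
    simp only [Nat.succ_eq_add_one] at h3
    rw [hnu]
    split_ifs <;> omega
  have hlast : nu.part j < lam.part j := by rw [hnuj]; have := hbig j le_rfl; omega
  refine ⟨nu, ⟨hsub, ?_⟩, ?_, ?_⟩
  · refine ribbon_of_rows r lam nu i j hij (by omega) ?_ ?_ hlast ?_
    · intro t ht
      rw [hnu]; split_ifs <;> omega
    · intro t h1 h2
      have := hbig (t + 1) (by omega)
      rw [hnu, if_neg (by omega), if_pos h2]; omega
    · rw [hnuj]; omega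
  · apply Finset.eq_of_subset_of_card_le
    · intro a ha
      obtain ⟨t, ht, rfl⟩ := (mem_beads _ _).1 ha
      rw [Finset.mem_insert, Finset.mem_erase]
      rcases lt_trichotomy t j with h | h | h
      · right
        rcases lt_or_ge t i with h' | h'
        · have := lam.antitone h'.le
          rw [hnu, if_pos h']
          exact ⟨by omega, (mem_beads _ _).2 ⟨t, ht, rfl⟩⟩
        · have h1 := hbig (t + 1) (by omega)
          have h2 := lam.antitone (show i ≤ t + 1 by omega)
          rw [hnu, if_neg (by omega), if_pos h]
          exact ⟨by omega, (mem_beads _ _).2 ⟨t + 1, by omega, by omega⟩⟩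
      · left; rw [h, hnuj]; omega
      · right
        have := lam.antitone (show i ≤ t by omega)
        rw [hnu, if_neg (by omega), if_neg (by omega), if_neg (by omega)]
        exact ⟨by omega, (mem_beads _ _).2 ⟨t, ht, rfl⟩⟩
    · rw [Finset.card_insert_of_notMem (fun h => hb' (Finset.mem_of_mem_erase h)),
        Finset.card_erase_of_mem hb, beads_card, beads_card]
      omega
  · exact Finset.sum_lt_sum (fun t _ => hsub t) ⟨j, Finset.mem_range.2 (by omega), hlast⟩

lemma reduce_flush {d w : ℕ} (r : ℕ) (hr : 1 ≤ r) (s : ℕ) : ∀ lam : PartitionIn d w,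
    lam.size = s →
    ∃ ka : PartitionIn d w, RibbonEquiv r lam ka ∧
      (∀ k, ((beads lam).filter (fun a => a % r = k % r)).card =
        ((beads ka).filter (fun a => a % r = k % r)).card) ∧
      (∀ b ∈ beads ka, r ≤ b → b - r ∈ beads ka) := by
  induction s using Nat.strong_induction_on with
  | _ s ih =>
    intro lam hs
    by_cases hfl : ∀ b ∈ beads lam, r ≤ b → b - r ∈ beads lam
    · exact ⟨lam, Relation.EqvGen.refl _, fun _ => rfl, hfl⟩
    · push Not at hfl
      obtain ⟨b, hb, hbr, hb'⟩ := hfl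
      obtain ⟨nu, h1, h2, h3⟩ := bead_move r hr lam b hb hbr hb'
      obtain ⟨ka, k1, k2, k3⟩ := ih nu.size (by omega) nu rfl
      refine ⟨ka, Relation.EqvGen.trans _ _ _ (Relation.EqvGen.rel _ _ h1) k1, fun k => ?_, k3⟩
      rw [← k2 k, h2, Finset.filter_insert, Finset.filter_erase]
      have hmod : (b - r) % r = b % r := by
        conv_rhs => rw [← Nat.sub_add_cancel hbr]
        simp
      rw [hmod]
      split_ifs with hk
      · have hbm : b ∈ (beads lam).filter (fun a => a % r = k % r) :=
          Finset.mem_filter.2 ⟨hb, hk⟩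
        rw [Finset.card_insert_of_notMem, Finset.card_erase_of_mem hbm]
        · have := Finset.card_pos.2 ⟨b, hbm⟩
          omega
        · intro h
          exact hb' (Finset.mem_filter.1 (Finset.mem_of_mem_erase h)).1
      · rw [Finset.erase_eq_of_notMem]
        intro h
        exact hk (Finset.mem_filter.1 h).2

lemma flush_lower (r : ℕ) (B : Finset ℕ) (hB : ∀ b ∈ B, r ≤ b → b - r ∈ B) (q : ℕ) :
    ∀ a, a + r * q ∈ B → a ∈ B := by
  induction q with
  | zero => intro a h; simpa using h
  | succ q ih =>
    intro a h
    have := hB _ h (by rw [Nat.mul_succ]; omega)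
    apply ih
    convert this using 1
    rw [Nat.mul_succ]; omega

lemma flush_lower' (r : ℕ) (B : Finset ℕ) (hB : ∀ b ∈ B, r ≤ b → b - r ∈ B)
    (a b : ℕ) (hab : a ≤ b) (hm : a % r = b % r) (hb : b ∈ B) : a ∈ B := by
  obtain ⟨q, hq⟩ := (Nat.modEq_iff_dvd' hab).1 hm
  exact flush_lower r B hB q a (by rw [← hq]; rwa [Nat.add_sub_cancel' hab])

lemma flush_sub (r : ℕ) (B B' : Finset ℕ) (hB : ∀ b ∈ B, r ≤ b → b - r ∈ B)
    (hB' : ∀ b ∈ B', r ≤ b → b - r ∈ B')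
    (hc : ∀ k, (B.filter (fun a => a % r = k % r)).card =
      (B'.filter (fun a => a % r = k % r)).card) : B ⊆ B' := by
  intro a ha
  by_contra ha'
  have hsub : B'.filter (fun t => t % r = a % r) ⊆ B.filter (fun t => t % r = a % r) := by
    intro t ht
    rw [Finset.mem_filter] at ht ⊢
    refine ⟨?_, ht.2⟩
    rcases le_total t a with h | h
    · exact flush_lower' r B hB t a h ht.2 ha
    · exact absurd (flush_lower' r B' hB' a t h ht.2.symm ht.1) ha'
  have heq := Finset.eq_of_subset_of_card_le hsub (hc a).le
  have : a ∈ B.filter (fun t => t % r = a % r) := Finset.mem_filter.2 ⟨ha, rfl⟩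
  rw [← heq] at this
  exact ha' (Finset.mem_filter.1 this).1

lemma ribbonEquiv_of_counts {d w : ℕ} (r : ℕ) (hr : 1 ≤ r) (lam mu : PartitionIn d w)
    (h : ∀ k, ((beads lam).filter (fun a => a % r = k % r)).card =
        ((beads mu).filter (fun a => a % r = k % r)).card) : RibbonEquiv r lam mu := by
  obtain ⟨k1, a1, b1, c1⟩ := reduce_flush r hr _ lam rfl
  obtain ⟨k2, a2, b2, c2⟩ := reduce_flush r hr _ mu rfl
  have hc : ∀ k, ((beads k1).filter (fun a => a % r = k % r)).card =
        ((beads k2).filter (fun a => a % r = k % r)).card := fun k => by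
    rw [← b1, ← b2, h]
  have he : k1 = k2 := beads_inj _ _ (Finset.Subset.antisymm
    (flush_sub r _ _ c1 c2 hc) (flush_sub r _ _ c2 c1 (fun k => (hc k).symm)))
  subst he
  exact Relation.EqvGen.trans _ _ _ a1 (Relation.EqvGen.symm _ _ a2)

/-! ### Ribbon tableaux -/

open Classical in
lemma srt_equiv {d w : ℕ} (r : ℕ) (lam mu : PartitionIn d w) (hsub : SubPartition mu lam)
    (l : ℕ) (E : ℕ → ℕ → ℕ) (hE : IsSRT r l lam mu E) : RibbonEquiv r lam mu := by
  obtain ⟨h0, h1, h2, h3, h4⟩ := hE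
  -- truncations
  have key : ∀ k : ℕ, ∃ nu : PartitionIn d w, ∀ i c,
      c < nu.part i ↔ (c < mu.part i ∨ (InShape lam mu i c ∧ E i c ≤ k)) := by
    intro k
    have hlow : ∀ i, ∃ q, ∀ c, c < q ↔ (c < mu.part i ∨ (InShape lam mu i c ∧ E i c ≤ k)) := by
      intro i
      have hex : ∃ c, ¬ (c < mu.part i ∨ (InShape lam mu i c ∧ E i c ≤ k)) := by
        refine ⟨lam.part i, ?_⟩
        rintro (h | ⟨⟨_, _, h⟩, _⟩)
        · have := hsub i; omega
        · omega
      refine ⟨Nat.find hex, fun c => ⟨fun h => not_not.1 (Nat.find_min hex h), fun h => ?_⟩⟩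
      by_contra hc
      apply Nat.find_spec hex
      rcases lt_or_ge (Nat.find hex) (mu.part i) with h' | h'
      · exact Or.inl h'
      · right
        rcases h with h | ⟨hs, hk⟩
        · omega
        · have hs' : InShape lam mu i (Nat.find hex) := ⟨hs.1, h', by have := hs.2.2; omega⟩
          exact ⟨hs', (h2 i _ _ hs' hs (by omega)).trans hk⟩
    choose q hq using hlow
    refine ⟨⟨q, ?_, ?_, ?_⟩, hq⟩
    · intro i j hij
      by_contra hlt
      push Not at hlt
      have hn := (hq i (q i)).not.1 (lt_irrefl _)
      apply hn
      rcases (hq j (q i)).1 hlt with h | ⟨hs, hk⟩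
      · left; have := mu.antitone hij; omega
      · rcases lt_or_ge (q i) (mu.part i) with h' | h'
        · exact Or.inl h'
        · right
          have hs' : InShape lam mu i (q i) :=
            ⟨by have := hs.1; omega, h', by have := hs.2.2; have := lam.antitone hij; omega⟩
          exact ⟨hs', (h3 i j _ hs' hs hij).trans hk⟩
    · intro i
      by_contra hlt
      push Not at hlt
      have := lam.le_w i
      have := hsub i
      rcases (hq i w).1 hlt with h | ⟨hs, hk⟩
      · omega
      · have := hs.2.2; omega
    · intro i hi
      by_contra hlt
      have := mu.eq_zero i hi
      rcases (hq i 0).1 (by omega) with h | ⟨hs, hk⟩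
      · omega
      · have := hs.1; omega
  choose nu hnu using key
  have hend : nu l = lam := by
    apply partitionIn_ext
    funext i
    refine eq_of_forall_lt_iff fun c => ?_
    rw [hnu]
    constructor
    · rintro (h | ⟨h, _⟩)
      · exact lt_of_lt_of_le h (hsub i)
      · exact h.2.2
    · intro h
      rcases lt_or_ge c (mu.part i) with h' | h'
      · exact Or.inl h'
      · have hid : i < d := by
          by_contra hid
          have := lam.eq_zero i (by omega); omega
        exact Or.inr ⟨⟨hid, h', h⟩, (h1 i c ⟨hid, h', h⟩).2⟩
  have hstart : nu 0 = mu := by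
    apply partitionIn_ext
    funext i
    refine eq_of_forall_lt_iff fun c => ?_
    rw [hnu]
    constructor
    · rintro (h | ⟨h, hk⟩)
      · exact h
      · have := (h1 i c h).1; omega
    · exact Or.inl
  have hind : ∀ k, k ≤ l → RibbonEquiv r (nu k) mu := by
    intro k
    induction k with
    | zero => intro _; rw [hstart]; exact Relation.EqvGen.refl _
    | succ k ih =>
      intro hk
      refine Relation.EqvGen.trans _ _ _ (Relation.EqvGen.rel _ _ ?_) (ih (by omega))
      refine ⟨fun i => ?_, ?_⟩
      · by_contra hlt
        push Not at hlt
        have hn := (hnu (k + 1) i _).not.1 (lt_irrefl _)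
        rcases (hnu k i _).1 hlt with h | ⟨h, h'⟩
        · exact hn (Or.inl h)
        · exact hn (Or.inr ⟨h, by omega⟩)
      · convert h4 (k + 1) (by omega) hk using 1
        ext ⟨i, c⟩
        simp only [Set.mem_ofPred_eq]
        constructor
        · rintro ⟨hid, ha, hb⟩
          have ha' := (hnu k i c).not.1 (by omega)
          rcases (hnu (k + 1) i c).1 hb with h | ⟨h, h'⟩
          · exact absurd (Or.inl h) ha'
          · refine ⟨h, ?_⟩
            by_contra hne
            exact ha' (Or.inr ⟨h, by omega⟩)
        · rintro ⟨h, he⟩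
          refine ⟨h.1, ?_, (hnu (k + 1) i c).2 (Or.inr ⟨h, he.le⟩)⟩
          by_contra hlt
          rcases (hnu k i c).1 (by omega) with h' | ⟨h', h''⟩
          · have := h.2.1; omega
          · omega
  have := hind l le_rfl
  rwa [hend] at this

lemma sum_plucker {d w : ℕ} (lam : PartitionIn d w) :
    ∑ i, pluckerIndex lam i = lam.size + ∑ i : Fin d, (i : ℕ) := by
  simp only [pluckerIndex, Finset.sum_add_distrib, PartitionIn.size]
  rw [add_comm, Fin.sum_univ_eq_sum_range (fun i => lam.part (d - 1 - i)) d,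
    Finset.sum_range_reflect]

/-- Let `h(z) = z^m (z^r + h₁) ⋯ (z^r + h_ℓ)` be a `C_r`-fixed
polynomial and `X_{λ/μ}` an `h`-compatible Richardson variety.  If `λ` and `μ`
do not have the same `r`-core, then `X^r_{λ/μ}(h) = X_{λ/μ} ∩ X^r ∩ Wr⁻¹(h)` is
empty; moreover there are no standard `r`-ribbon tableaux of shape `λ/μ`. -/
theorem statement18 (d n r m ℓ : ℕ) (hd : 0 < d) (hdn : d < n) (hr : 1 ≤ r)
    (hml : m + r * ℓ ≤ d * (n - d))
    (hs : Fin ℓ → ℂ) (hhs : ∀ i, hs i ≠ 0)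
    (lam mu : PartitionIn d (n - d))
    (hcomp : Compatible n d lam mu (crPoly r m ℓ hs))
    (hcore : ¬ RibbonEquiv r lam mu) :
    {x : Submodule ℂ (Polynomial ℂ) |
        IsGrPoint n d x ∧ InRichardson n d lam mu x ∧ CrFixed r x ∧
        InFibre d x (crPoly r m ℓ hs)} = ∅ ∧
    ∀ ℓ' : ℕ, ¬ ∃ E : ℕ → ℕ → ℕ, IsSRT r ℓ' lam mu E := by
  classical
  obtain ⟨hsub, hlam, hmu⟩ := hcomp
  refine ⟨?_, fun l' ⟨E, hE⟩ => hcore (srt_equiv r lam mu hsub l' E hE)⟩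
  rw [Set.eq_empty_iff_forall_notMem]
  rintro x ⟨⟨hxn, hxd⟩, hrich, hfix, f, c, hc, _, hspan, hW⟩
  apply hcore
  have hfin : FiniteDimensional ℂ x := Module.finite_of_finrank_pos (by omega)
  have hh0 : crPoly r m ℓ hs ≠ 0 := by
    unfold crPoly
    refine mul_ne_zero (pow_ne_zero _ Polynomial.X_ne_zero) (Finset.prod_ne_zero_iff.2 ?_)
    intro i _
    exact (Polynomial.monic_X_pow_add_C _ (by omega)).ne_zero
  have hW0 : wronskDet d f ≠ 0 := by rw [hW]; exact smul_ne_zero hc hh0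
  have hfx : ∀ i, f i ∈ x := fun i => by rw [← hspan]; exact Submodule.subset_span ⟨i, rfl⟩
  have hdeg : (wronskDet d f).natDegree = lam.size := by
    rw [hW, Polynomial.natDegree_smul _ hc, hlam]
  have hord : (wronskDet d f).rootMultiplicity 0 = mu.size := by
    rw [hW, hmu, Polynomial.smul_eq_C_mul, Polynomial.rootMultiplicity_mul
      (mul_ne_zero (Polynomial.C_ne_zero.2 hc) hh0), Polynomial.rootMultiplicity_C, zero_add]
  have hD := degs_eq n d x hxn hxd (pluckerIndex lam) (fun i => by
    have h := (hrich i i.2).2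
    have e : pluckerIndex lam i + 1 = lam.part (d - 1 - i) + (i + 1) := by
      simp only [pluckerIndex]; omega
    rw [e]; exact h) f hfx hW0 (by rw [hdeg, sum_plucker])
  have hO := ords_eq n d x hxn hxd (pluckerIndex mu) (fun i => by
    have hi := i.2
    have h := (hrich (d - 1 - i) (by omega)).1
    have hw := mu.le_w (d - 1 - i)
    have e : pluckerIndex mu i =
        n - (n - d - mu.part (d - 1 - i) + (d - 1 - i + 1)) := by
      simp only [pluckerIndex]; omega
    have e2 : x ⊓ Fflag n (n - d - mu.part (d - 1 - i) + (d - 1 - i + 1)) =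
        x ⊓ ordGE (pluckerIndex mu i) := by
      rw [e, Fflag, ordGE, ← inf_assoc, inf_eq_left.2 hxn]
    rw [e2] at h
    omega) f hfx hW0 (by rw [hord, sum_plucker])
  apply ribbonEquiv_of_counts r hr
  intro k
  have := res_count n r hr x hxn hfix k
  rw [hD, hO] at this
  exact this
end
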